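/- Every category of partitions C satisfies at least one of the following: (i) C is non-hyperoctahedral; (ii) C = ⟨π_l, l ≤ k⟩ for some k ∈ {1,2,…} ∪ {∞}; (iii) C is group-theoretical and hyperoctahedral. -/

import Mathlib

/-!
Basic combinatorics of categories of partitions (Banica–Speicher easy quantum groups).

A partition with `k` upper and `l` lower points is encoded as an equivalence
relation (a `Setoid`) on the set `Fin k ⊕ Fin l` of its points; its blocks are
the equivalence classes.
-/

namespace EasyQG

/-- A partition of `k` upper and `l` lower points into blocks. -/
abbrev Partition (k l : ℕ) : Type := Setoid (Fin k ⊕ Fin l)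

/-- The relation "lying in the same block" of a partition. -/
def inSameBlock {k l : ℕ} (p : Partition k l) :
    (Fin k ⊕ Fin l) → (Fin k ⊕ Fin l) → Prop :=
  @Setoid.r _ p

/-- The partition in `P(0,n)` associated to a word: two points lie in the same
block iff they carry the same letter. -/
def ofWord {n : ℕ} (w : Fin n → ℕ) : Partition 0 n :=
  Setoid.ker (Sum.elim Fin.elim0 w)

/-- The partition in `P(0,n)` associated to a word given as a list of letters. -/
def ofList (w : List ℕ) : Partition 0 w.length :=
  ofWord w.get

/-- The identity partition `|` in `P(1,1)`: one upper point joined to one lower point. -/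
def idPartition : Partition 1 1 := ⊤

/-- The pair partition `⊓` in `P(0,2)`: two points in one block. -/
def pairPartition : Partition 0 2 := ⊤

/-- The double singleton `↓⊗↓` in `P(0,2)`: two points in two different blocks. -/
def doubleSingleton : Partition 0 2 := ⊥

/-- The four block partition `⊓⊓` in `P(0,4)`: four points in one block (word `aaaa`). -/
def fourBlock : Partition 0 4 := ⊤

/-- The fat crossing partition in `P(4,4)`, with blocks `{1,2,3',4'}` and `{3,4,1',2'}`. -/
def fatCross : Partition 4 4 :=
  Setoid.ker (Sum.elim (fun i => decide (i.val < 2)) (fun j => decide (2 ≤ j.val)))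

/-- The pair positioner partition in `P(3,3)`, with blocks `{1,2,2',3'}` and `{3,1'}`. -/
def pairPositioner : Partition 3 3 :=
  Setoid.ker (Sum.elim (fun i => decide (i.val < 2)) (fun j => decide (1 ≤ j.val)))

/-- The `s`-mixing partition `h_s ∈ P(0,2s)`, the word `abab…ab` of length `2s`. -/
def sMixing (s : ℕ) : Partition 0 (2 * s) := ofWord (fun i => i.val % 2)

/-- The partition `π_k ∈ P(0,4k)`, the word `a₁…a_k a_k…a₁ a₁…a_k a_k…a₁`
in `k` distinct letters. -/
def piPartition (k : ℕ) : Partition 0 (4 * k) :=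
  ofWord (fun i =>
    if i.val % (2 * k) < k then i.val % (2 * k) else 2 * k - 1 - i.val % (2 * k))

/-- The disjoint sum of two set partitions. -/
def sumSetoid {α β : Type*} (ra : Setoid α) (rb : Setoid β) : Setoid (α ⊕ β) where
  r := Sum.LiftRel (@Setoid.r _ ra) (@Setoid.r _ rb)
  iseqv := by
    constructor
    · intro x
      cases x with
      | inl a => exact Sum.LiftRel.inl (ra.iseqv.refl a)
      | inr b => exact Sum.LiftRel.inr (rb.iseqv.refl b)
    · intro x y h
      cases h with
      | inl h => exact Sum.LiftRel.inl (ra.iseqv.symm h)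
      | inr h => exact Sum.LiftRel.inr (rb.iseqv.symm h)
    · intro x y z h1 h2
      cases h1 with
      | inl h1 => cases h2 with
        | inl h2 => exact Sum.LiftRel.inl (ra.iseqv.trans h1 h2)
      | inr h1 => cases h2 with
        | inr h2 => exact Sum.LiftRel.inr (rb.iseqv.trans h1 h2)

/-- Tensor product (horizontal concatenation) of partitions. -/
def tensor {k l k' l' : ℕ} (p : Partition k l) (q : Partition k' l') :
    Partition (k + k') (l + l') :=
  Setoid.comap
    (fun x => (Equiv.sumSumSumComm (Fin k) (Fin k') (Fin l) (Fin l'))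
      (Sum.map finSumFinEquiv.symm finSumFinEquiv.symm x))
    (sumSetoid p q)

/-- Composition (vertical concatenation) of partitions `p ∈ P(k,l)` and `q ∈ P(l,m)`:
blocks are joined along the `l` middle points, which are then deleted. -/
def comp {k l m : ℕ} (p : Partition k l) (q : Partition l m) : Partition k m :=
  Setoid.comap (Sum.map id Sum.inr)
    (Relation.EqvGen.setoid (fun x y : Fin k ⊕ (Fin l ⊕ Fin m) =>
      (∃ a b, inSameBlock p a b ∧ Sum.map id Sum.inl a = x ∧ Sum.map id Sum.inl b = y) ∨
      (∃ a b, inSameBlock q a b ∧ Sum.inr a = x ∧ Sum.inr b = y)))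

/-- Involution (turning a partition upside down). -/
def involution {k l : ℕ} (p : Partition k l) : Partition l k :=
  Setoid.comap Sum.swap p

/-- Rotation moving the leftmost upper point to the left end of the lower row. -/
def rotUL {k l : ℕ} (p : Partition (k + 1) l) : Partition k (l + 1) :=
  Setoid.comap
    (Sum.elim (fun i => Sum.inl i.succ)
      (fun j => Fin.cases (Sum.inl (0 : Fin (k + 1))) (fun j' => Sum.inr j') j)) p

/-- Rotation moving the leftmost lower point to the left end of the upper row. -/
def rotLU {k l : ℕ} (p : Partition k (l + 1)) : Partition (k + 1) l :=
  Setoid.comap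
    (Sum.elim (fun i => Fin.cases (Sum.inr (0 : Fin (l + 1))) (fun i' => Sum.inl i') i)
      (fun j => Sum.inr j.succ)) p

/-- Rotation moving the rightmost upper point to the right end of the lower row. -/
def rotUR {k l : ℕ} (p : Partition (k + 1) l) : Partition k (l + 1) :=
  Setoid.comap
    (Sum.elim (fun i => Sum.inl i.castSucc)
      (fun j => Fin.lastCases (Sum.inl (Fin.last k)) (fun j' => Sum.inr j') j)) p

/-- Rotation moving the rightmost lower point to the right end of the upper row. -/
def rotRU {k l : ℕ} (p : Partition k (l + 1)) : Partition (k + 1) l :=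
  Setoid.comap
    (Sum.elim (fun i => Fin.lastCases (Sum.inr (Fin.last l)) (fun i' => Sum.inl i') i)
      (fun j => Sum.inr j.castSucc)) p

/-- A category of partitions: a collection of partitions containing the identity
partition and closed under the category operations (tensor product, composition,
involution and the four rotations). -/
structure PartitionCategory where
  mem : Set (Σ k l : ℕ, Partition k l)
  id_mem : ⟨1, 1, idPartition⟩ ∈ mem
  tensor_mem : ∀ {k l k' l' : ℕ} {p : Partition k l} {q : Partition k' l'},
    ⟨k, l, p⟩ ∈ mem → ⟨k', l', q⟩ ∈ mem → ⟨k + k', l + l', tensor p q⟩ ∈ mem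
  comp_mem : ∀ {k l m : ℕ} {p : Partition k l} {q : Partition l m},
    ⟨k, l, p⟩ ∈ mem → ⟨l, m, q⟩ ∈ mem → ⟨k, m, comp p q⟩ ∈ mem
  involution_mem : ∀ {k l : ℕ} {p : Partition k l},
    ⟨k, l, p⟩ ∈ mem → ⟨l, k, involution p⟩ ∈ mem
  rotUL_mem : ∀ {k l : ℕ} {p : Partition (k + 1) l},
    ⟨k + 1, l, p⟩ ∈ mem → ⟨k, l + 1, rotUL p⟩ ∈ mem
  rotLU_mem : ∀ {k l : ℕ} {p : Partition k (l + 1)},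
    ⟨k, l + 1, p⟩ ∈ mem → ⟨k + 1, l, rotLU p⟩ ∈ mem
  rotUR_mem : ∀ {k l : ℕ} {p : Partition (k + 1) l},
    ⟨k + 1, l, p⟩ ∈ mem → ⟨k, l + 1, rotUR p⟩ ∈ mem
  rotRU_mem : ∀ {k l : ℕ} {p : Partition k (l + 1)},
    ⟨k, l + 1, p⟩ ∈ mem → ⟨k + 1, l, rotRU p⟩ ∈ mem

/-- The members of the smallest category of partitions containing `S`
(the category `⟨S⟩` generated by `S`). -/
def generated (S : Set (Σ k l : ℕ, Partition k l)) : Set (Σ k l : ℕ, Partition k l) :=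
  {x | ∀ C : PartitionCategory, S ⊆ C.mem → x ∈ C.mem}

/-- A category of partitions is hyperoctahedral if it contains the four block
partition `⊓⊓` but not the double singleton `↓⊗↓`. -/
def Hyperoctahedral (C : PartitionCategory) : Prop :=
  (⟨0, 4, fourBlock⟩ : Σ k l : ℕ, Partition k l) ∈ C.mem ∧
    (⟨0, 2, doubleSingleton⟩ : Σ k l : ℕ, Partition k l) ∉ C.mem

/-- A category of partitions is group-theoretical if it contains the pair
positioner partition. -/
def GroupTheoretical (C : PartitionCategory) : Prop :=
  (⟨3, 3, pairPositioner⟩ : Σ k l : ℕ, Partition k l) ∈ C.mem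

/-- The generating set `{π_l | 1 ≤ l ≤ k}`. -/
def piUpTo (k : ℕ) : Set (Σ k l : ℕ, Partition k l) :=
  {x | ∃ l : ℕ, 1 ≤ l ∧ l ≤ k ∧ x = ⟨0, 4 * l, piPartition l⟩}

/-- The generating set `{π_l | l ∈ ℕ, l ≥ 1}`. -/
def piAll : Set (Σ k l : ℕ, Partition k l) :=
  {x | ∃ l : ℕ, 1 ≤ l ∧ x = ⟨0, 4 * l, piPartition l⟩}

end EasyQG
namespace EasyQG

/-- Merging the blocks of the points `x` and `y` of a partition. -/
def merge {k l : ℕ} (p : Partition k l) (x y : Fin k ⊕ Fin l) : Partition k l :=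
  Relation.EqvGen.setoid (fun u v => inSameBlock p u v ∨ (u = x ∧ v = y) ∨ (u = y ∧ v = x))

/-- The word `a_{i(1)}^{k(1)} … a_{i(m)}^{k(m)}` determined by a list of
letters with exponents. -/
def expand (blocks : List (ℕ × ℕ)) : List ℕ :=
  (blocks.map fun be => List.replicate be.2 be.1).flatten

/-- The run decomposition of a word: the list of its (letter, exponent) blocks. -/
def runs : List ℕ → List (ℕ × ℕ)
  | [] => []
  | a :: rest =>
    match runs rest with
    | [] => [(a, 1)]
    | (b, e) :: rs => if a = b then (b, e + 1) :: rs else (a, 1) :: (b, e) :: rs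

/-- The single-double leg form associated to a word: every odd exponent is
replaced by `1` and every even exponent by `2`. -/
def sdForm (w : List ℕ) : List ℕ :=
  expand ((runs w).map fun be => (be.1, if Odd be.2 then 1 else 2))

/-- A word is in single-double leg form if all its exponents are `1` or `2`. -/
def IsSingleDoubleLegForm (w : List ℕ) : Prop :=
  ∃ blocks : List (ℕ × ℕ), List.Chain' (fun x y => x.1 ≠ y.1) blocks ∧
    (∀ b ∈ blocks, b.2 = 1 ∨ b.2 = 2) ∧ w = expand blocks

/-- The vertical reflection of a partition: the left-to-right order of the
points is reversed in both rows, keeping the block structure. -/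
def verticalReflect {k l : ℕ} (p : Partition k l) : Partition k l :=
  Setoid.comap (Sum.map Fin.rev Fin.rev) p

/-- `leg [a₁,…,a_k] [X₁,…,X_{k-1}] = a₁ X₁ a₂ X₂ … a_{k-1} X_{k-1} a_k`:
a list of letters interleaved with filler words. -/
def leg : List ℕ → List (List ℕ) → List ℕ
  | [], _ => []
  | [a], _ => [a]
  | a :: rest, Xs => a :: (Xs.headD [] ++ leg rest Xs.tail)

/-- A word contains a W of depth `k` if it can be written as
`Y₁ S_α X_k^α S_β Y₂ S_γ X_k^γ S_δ Y₃`, where `S_α = a₁X₁^α a₂X₂^α…a_k`,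
`S_β = a_k X_{k-1}^β…X₁^β a₁`, `S_γ = a₁X₁^γ…a_k`, `S_δ = a_k X_{k-1}^δ…X₁^δ a₁`
for `k` distinct letters `a₁,…,a_k`, each of which occurs an odd number of
times in each of `S_α`, `S_β`, `S_γ`, `S_δ`. -/
def ContainsW (w : List ℕ) (k : ℕ) : Prop :=
  ∃ (as : List ℕ) (Xa Xb Xc Xd : List (List ℕ)) (Xka Xkc Y1 Y2 Y3 : List ℕ),
    as.length = k ∧ as.Nodup ∧
    Xa.length = k - 1 ∧ Xb.length = k - 1 ∧ Xc.length = k - 1 ∧ Xd.length = k - 1 ∧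
    w = Y1 ++ leg as Xa ++ Xka ++ leg as.reverse Xb ++ Y2 ++
        leg as Xc ++ Xkc ++ leg as.reverse Xd ++ Y3 ∧
    ∀ a ∈ as, Odd ((leg as Xa).count a) ∧ Odd ((leg as.reverse Xb).count a) ∧
      Odd ((leg as Xc).count a) ∧ Odd ((leg as.reverse Xd).count a)

/-- `wdepth w` is the maximal `k` such that some rotated version of the
word `w` contains a W of depth `k`. -/
noncomputable def wdepth (w : List ℕ) : ℕ :=
  sSup {k | ∃ r : ℕ, ContainsW (w.rotate r) k}

end EasyQG

namespace EasyQG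
/-- Membership of the partition with labels `u` (upper) and `v` (lower). -/
def LM (C : PartitionCategory) {k l : ℕ} (u : Fin k → ℕ) (v : Fin l → ℕ) : Prop :=
  (⟨k, l, Setoid.ker (Sum.elim u v)⟩ : Σ k l : ℕ, Partition k l) ∈ C.mem

/-- The words of a category. -/
def Wd (C : PartitionCategory) (w : List ℕ) : Prop :=
  LM C (Fin.elim0 : Fin 0 → ℕ) w.get

theorem LM_congr (C : PartitionCategory) {k l : ℕ} {u u' : Fin k → ℕ} {v v' : Fin l → ℕ}
    (h : ∀ x y, Sum.elim u v x = Sum.elim u v y ↔ Sum.elim u' v' x = Sum.elim u' v' y)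
    (hm : LM C u v) : LM C u' v' := by
  have : Setoid.ker (Sum.elim u v) = Setoid.ker (Sum.elim u' v') := Setoid.ext h
  unfold LM at *
  rwa [← this]

theorem Wd_iff (C : PartitionCategory) {n : ℕ} (f : Fin n → ℕ) (u : Fin 0 → ℕ) (w : List ℕ)
    (hn : w.length = n) (h : ∀ (i : ℕ) (h1 : i < w.length) (h2 : i < n), w[i] = f ⟨i, h2⟩) :
    Wd C w ↔ LM C u f := by
  subst hn
  have : w.get = f := by
    funext i
    exact h i.1 i.2 i.2
  unfold Wd
  rw [this, Subsingleton.elim u Fin.elim0]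

theorem LM_rotLU (C : PartitionCategory) {k l : ℕ} (u : Fin k → ℕ) (v : Fin (l + 1) → ℕ) :
    LM C u v → LM C (Fin.cons (v 0) u : Fin (k + 1) → ℕ) (fun i => v i.succ) := by
  intro h
  have h2 := C.rotLU_mem h
  have : rotLU (Setoid.ker (Sum.elim u v)) =
      Setoid.ker (Sum.elim (Fin.cons (v 0) u : Fin (k + 1) → ℕ) (fun i => v i.succ)) := by
    have e : ∀ x, Sum.elim u v ((Sum.elim (fun i => Fin.cases (Sum.inr (0 : Fin (l + 1))) (fun i' => Sum.inl i') i)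
      (fun j => Sum.inr j.succ) : Fin (k + 1) ⊕ Fin l → Fin k ⊕ Fin (l + 1)) x) =
        Sum.elim (Fin.cons (v 0) u : Fin (k + 1) → ℕ) (fun i => v i.succ) x := by
      rintro (i | i)
      · refine Fin.cases ?_ (fun j => ?_) i <;> simp
      · simp
    apply Setoid.ext
    intro x y
    exact iff_of_eq (congrArg₂ (· = ·) (e x) (e y))
  unfold LM
  rwa [← this]

theorem LM_rotUL (C : PartitionCategory) {k l : ℕ} (u : Fin (k + 1) → ℕ) (v : Fin l → ℕ) :
    LM C u v → LM C (fun i => u i.succ) (Fin.cons (u 0) v : Fin (l + 1) → ℕ) := by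
  intro h
  have h2 := C.rotUL_mem h
  have : rotUL (Setoid.ker (Sum.elim u v)) =
      Setoid.ker (Sum.elim (fun i => u i.succ) (Fin.cons (u 0) v : Fin (l + 1) → ℕ)) := by
    have e : ∀ x, Sum.elim u v ((Sum.elim (fun i => Sum.inl i.succ)
      (fun j => Fin.cases (Sum.inl (0 : Fin (k + 1))) (fun j' => Sum.inr j') j) : Fin k ⊕ Fin (l + 1) → Fin (k + 1) ⊕ Fin l) x) =
        Sum.elim (fun i => u i.succ) (Fin.cons (u 0) v : Fin (l + 1) → ℕ) x := by
      rintro (i | i)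
      · simp
      · refine Fin.cases ?_ (fun j => ?_) i <;> simp
    apply Setoid.ext
    intro x y
    exact iff_of_eq (congrArg₂ (· = ·) (e x) (e y))
  unfold LM
  rwa [← this]

theorem LM_rotUR (C : PartitionCategory) {k l : ℕ} (u : Fin (k + 1) → ℕ) (v : Fin l → ℕ) :
    LM C u v → LM C (fun i => u i.castSucc)
      (Fin.snoc (α := fun _ => ℕ) v (u (Fin.last k)) : Fin (l + 1) → ℕ) := by
  intro h
  have h2 := C.rotUR_mem h
  have : rotUR (Setoid.ker (Sum.elim u v)) =
      Setoid.ker (Sum.elim (fun i => u i.castSucc)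
        (Fin.snoc (α := fun _ => ℕ) v (u (Fin.last k)) : Fin (l + 1) → ℕ)) := by
    have e : ∀ x, Sum.elim u v ((Sum.elim (fun i => Sum.inl i.castSucc)
      (fun j => Fin.lastCases (Sum.inl (Fin.last k)) (fun j' => Sum.inr j') j) : Fin k ⊕ Fin (l + 1) → Fin (k + 1) ⊕ Fin l) x) =
        Sum.elim (fun i => u i.castSucc)
          (Fin.snoc (α := fun _ => ℕ) v (u (Fin.last k)) : Fin (l + 1) → ℕ) x := by
      rintro (i | i)
      · simp
      · refine Fin.lastCases ?_ (fun j => ?_) i <;> simp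
    apply Setoid.ext
    intro x y
    exact iff_of_eq (congrArg₂ (· = ·) (e x) (e y))
  unfold LM
  rwa [← this]

/-- Closure properties of the set of words of a category. -/
structure WordCat (W : List ℕ → Prop) : Prop where
  ren : ∀ (w : List ℕ) (f : ℕ → ℕ), (∀ x ∈ w, ∀ y ∈ w, f x = f y → x = y) → W w → W (w.map f)
  rot : ∀ a w, W (a :: w) → W (w ++ [a])
  con : ∀ x y w, W (x :: y :: w) → W (w.map fun t => if t = y then x else t)
  ten : ∀ u v, W u → W v → (∀ x ∈ u, x ∉ v) → W (u ++ v)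
  pair : W [0, 0]

theorem Wd_ren (C : PartitionCategory) (w : List ℕ) (f : ℕ → ℕ)
    (hf : ∀ x ∈ w, ∀ y ∈ w, f x = f y → x = y) (h : Wd C w) : Wd C (w.map f) := by
  rw [Wd_iff C (fun i : Fin w.length => f (w.get i)) Fin.elim0 (w.map f) (by simp) (by simp)]
  refine LM_congr C ?_ h
  rintro (x | x) (y | y)
  · exact x.elim0
  · exact x.elim0
  · exact y.elim0
  · simp only [Sum.elim_inr]
    constructor
    · intro h; rw [h]
    · intro h; exact hf _ (List.get_mem _ _) _ (List.get_mem _ _) h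

theorem Wd_rot (C : PartitionCategory) (a : ℕ) (w : List ℕ) (h : Wd C (a :: w)) :
    Wd C (w ++ [a]) := by
  have h1 := LM_rotUR C _ _ (LM_rotLU C _ _ h)
  refine (Wd_iff C _ _ _ (by simp) ?_).2 h1
  intro i hi1 hi2
  by_cases hi : i < w.length
  · rw [List.getElem_append_left hi]
    have : (⟨i, hi2⟩ : Fin (w.length + 1)) = Fin.castSucc ⟨i, hi⟩ := rfl
    rw [this, Fin.snoc_castSucc]
    simp
  · have hi' : i = w.length := by simp at hi1; omega
    subst hi'
    have : (⟨w.length, hi2⟩ : Fin (w.length + 1)) = Fin.last _ := rfl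
    rw [this, Fin.snoc_last]
    simp [Fin.last]

theorem pair_mem (C : PartitionCategory) : LM C (Fin.elim0 : Fin 0 → ℕ) (fun _ : Fin 2 => 0) := by
  have h : LM C (fun _ : Fin 1 => 0) (fun _ : Fin 1 => 0) := by
    have := C.id_mem
    unfold LM
    convert this
    apply Setoid.ext
    intro x y
    simp only [Setoid.ker_def, idPartition]
    constructor
    · intro _; trivial
    · intro _; rcases x with x | x <;> rcases y with y | y <;> rfl
  have h2 := LM_rotUL C _ _ h
  refine LM_congr C ?_ (u := fun i => (fun _ : Fin 1 => 0) i.succ) h2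
  rintro (x | x) (y | y)
  · exact x.elim0
  · exact x.elim0
  · exact y.elim0
  · simp only [Sum.elim_inr]
    fin_cases x <;> fin_cases y <;> simp

theorem Wd_con (C : PartitionCategory) (x y : ℕ) (w : List ℕ) (h : Wd C (x :: y :: w)) :
    Wd C (w.map fun t => if t = y then x else t) := by
  have h1 := LM_rotLU C _ _ (LM_rotLU C _ _ h)
  have h2 := C.comp_mem (pair_mem C) h1
  rw [Wd_iff C (fun i : Fin w.length => if w.get i = y then x else w.get i) Fin.elim0 _
    (by simp) (by simp)]
  unfold LM
  convert h2 using 3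
  apply Setoid.ext
  intro a b
  rcases a with a | a
  · exact a.elim0
  rcases b with b | b
  · exact b.elim0
  set u : Fin 2 → ℕ := Fin.cons ((x :: y :: w).get (Fin.succ 0)) (Fin.cons ((x :: y :: w).get 0) Fin.elim0) with hu
  have u0 : u 0 = y := by simp [hu]
  have u1 : u 1 = x := by
    have : (1 : Fin 2) = Fin.succ 0 := rfl
    rw [hu, this, Fin.cons_succ]; simp
  set R : (Fin 0 ⊕ (Fin 2 ⊕ Fin w.length)) → (Fin 0 ⊕ (Fin 2 ⊕ Fin w.length)) → Prop :=
    (fun p q : Fin 0 ⊕ (Fin 2 ⊕ Fin w.length) =>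
      (∃ a b, inSameBlock (Setoid.ker (Sum.elim Fin.elim0 fun _ : Fin 2 => 0)) a b ∧ Sum.map id Sum.inl a = p ∧ Sum.map id Sum.inl b = q) ∨
      (∃ a b, inSameBlock (Setoid.ker (Sum.elim u w.get)) a b ∧ Sum.inr a = p ∧ Sum.inr b = q)) with hR
  change ((if w.get a = y then x else w.get a) = (if w.get b = y then x else w.get b)) ↔
    Relation.EqvGen R (Sum.inr (Sum.inr a)) (Sum.inr (Sum.inr b))
  constructor
  · intro hab
    have step : ∀ c d : Fin 2 ⊕ Fin w.length, Sum.elim u w.get c = Sum.elim u w.get d →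
        Relation.EqvGen R (Sum.inr c) (Sum.inr d) := by
      intro c d hcd
      exact Relation.EqvGen.rel _ _ (Or.inr ⟨c, d, hcd, rfl, rfl⟩)
    have mid : Relation.EqvGen R (Sum.inr (Sum.inl 0)) (Sum.inr (Sum.inl 1)) := by
      refine Relation.EqvGen.rel _ _ (Or.inl ⟨Sum.inr 0, Sum.inr 1, ?_, rfl, rfl⟩)
      rfl
    have key : ∀ c : Fin w.length, (w.get c = x ∨ w.get c = y) →
        Relation.EqvGen R (Sum.inr (Sum.inr c)) (Sum.inr (Sum.inl 0)) := by
      rintro c (hc | hc)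
      · exact (step (Sum.inr c) (Sum.inl 1) (by change w.get c = u 1; rw [u1, hc])).trans _ _ _ mid.symm
      · exact step (Sum.inr c) (Sum.inl 0) (by change w.get c = u 0; rw [u0, hc])
    by_cases hab' : w.get a = w.get b
    · exact step _ _ hab'
    · have aux : ∀ p q : ℕ, (if p = y then x else p) = (if q = y then x else q) → p ≠ q →
          (p = x ∨ p = y) ∧ (q = x ∨ q = y) := by
        intro p q; grind
      obtain ⟨ha, hb⟩ := aux _ _ hab hab'
      exact (key a ha).trans _ _ _ (key b hb).symm
  · intro hab
    let φ : Fin 0 ⊕ (Fin 2 ⊕ Fin w.length) → ℕ :=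
      Sum.elim Fin.elim0 (fun c => if Sum.elim u w.get c = y then x else Sum.elim u w.get c)
    have : ∀ p q, Relation.EqvGen R p q → φ p = φ q := by
      intro p q hpq
      induction hpq with
      | rel p q h =>
        rcases h with ⟨c, d, _, hc, hd⟩ | ⟨c, d, hcd, hc, hd⟩
        · rcases c with c | c
          · exact c.elim0
          rcases d with d | d
          · exact d.elim0
          have : ∀ c : Fin 2, φ (Sum.inr (Sum.inl c)) = x := by
            intro c
            fin_cases c <;> simp [φ, u0, u1]
          subst hc hd
          simp only [Sum.map_inr, this]
        · have hcd' : Sum.elim u w.get c = Sum.elim u w.get d := hcd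
          subst hc hd
          simp only [φ, Sum.elim_inr, hcd']
      | refl => rfl
      | symm _ _ _ ih => exact ih.symm
      | trans _ _ _ _ _ ih1 ih2 => exact ih1.trans ih2
    exact this _ _ hab

theorem Wd_ten (C : PartitionCategory) (u v : List ℕ) (hu : Wd C u) (hv : Wd C v)
    (hd : ∀ x ∈ u, x ∉ v) : Wd C (u ++ v) := by
  have h := C.tensor_mem hu hv
  refine (Wd_iff C (fun i : Fin (u.length + v.length) => (u ++ v).get (i.cast (by simp))) Fin.elim0 (u ++ v) (by simp) (by simp)).2 ?_
  unfold LM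
  convert h using 3
  apply Setoid.ext
  rintro (a | a) (b | b)
  · exact a.elim0
  · exact a.elim0
  · exact b.elim0
  · have hl : ∀ i : Fin u.length, (u ++ v).get ((Fin.castAdd v.length i).cast (by simp)) = u.get i := by
      intro i; simp
    have hr : ∀ i : Fin v.length, (u ++ v).get ((Fin.natAdd u.length i).cast (by simp)) = v.get i := by
      intro i; simp
    change ((u ++ v).get (a.cast (by simp)) = (u ++ v).get (b.cast (by simp))) ↔
      Sum.LiftRel
        (fun a b => (Sum.elim (Fin.elim0 : Fin 0 → ℕ) u.get a = Sum.elim Fin.elim0 u.get b))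
        (fun a b => (Sum.elim (Fin.elim0 : Fin 0 → ℕ) v.get a = Sum.elim Fin.elim0 v.get b))
        ((Equiv.sumSumSumComm (Fin 0) (Fin 0) (Fin u.length) (Fin v.length))
          (Sum.inr (finSumFinEquiv.symm a)))
        ((Equiv.sumSumSumComm (Fin 0) (Fin 0) (Fin u.length) (Fin v.length))
          (Sum.inr (finSumFinEquiv.symm b)))
    refine Fin.addCases (fun i => ?_) (fun i => ?_) a <;>
    refine Fin.addCases (fun j => ?_) (fun j => ?_) b
    · rw [hl, hl]
      simp only [finSumFinEquiv_symm_apply_castAdd]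
      exact ⟨fun h => Sum.LiftRel.inl h, fun h => by cases h with | inl h => exact h⟩
    · rw [hl, hr]
      simp only [finSumFinEquiv_symm_apply_castAdd, finSumFinEquiv_symm_apply_natAdd]
      exact ⟨fun h => absurd (List.get_mem v j) (h ▸ hd _ (List.get_mem u i)), fun h => by cases h⟩
    · rw [hl, hr]
      simp only [finSumFinEquiv_symm_apply_castAdd, finSumFinEquiv_symm_apply_natAdd]
      exact ⟨fun h => absurd (List.get_mem v i) (h ▸ hd _ (List.get_mem u j)), fun h => by cases h⟩
    · rw [hr, hr]
      simp only [finSumFinEquiv_symm_apply_natAdd]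
      exact ⟨fun h => Sum.LiftRel.inr h, fun h => by cases h with | inr h => exact h⟩

theorem Wd_cat (C : PartitionCategory) : WordCat (Wd C) where
  ren := Wd_ren C
  rot := Wd_rot C
  con := Wd_con C
  ten := Wd_ten C
  pair := (Wd_iff C _ _ _ rfl (by
    intro i h1 h2
    have : i = 0 ∨ i = 1 := by (simp at h1; omega)
    rcases this with rfl | rfl <;> rfl)).2 (pair_mem C)

/-- A category is determined by its words. -/
theorem mem_mono (C D : PartitionCategory) (h : ∀ w, Wd C w → Wd D w) : C.mem ⊆ D.mem := by
  have key : ∀ k l (p : Partition k l), (⟨k, l, p⟩ : Σ k l : ℕ, Partition k l) ∈ C.mem →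
      (⟨k, l, p⟩ : Σ k l : ℕ, Partition k l) ∈ D.mem := by
    intro k
    induction k with
    | zero =>
      intro l p hp
      obtain ⟨f, hf⟩ : ∃ f : Fin l → ℕ, p = Setoid.ker (Sum.elim (Fin.elim0 : Fin 0 → ℕ) f) := by
        classical
        obtain ⟨g, hg⟩ := Countable.exists_injective_nat (Quotient p)
        refine ⟨fun i => g (Quotient.mk p (Sum.inr i)), ?_⟩
        apply Setoid.ext
        rintro (a | a) (b | b)
        · exact a.elim0
        · exact a.elim0
        · exact b.elim0
        · simp only [Setoid.ker_def, Sum.elim_inr]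
          rw [hg.eq_iff, Quotient.eq]
      subst hf
      have e := fun C => Wd_iff C f Fin.elim0 (List.ofFn f) (by simp) (by simp)
      exact (e D).1 (h _ ((e C).2 hp))
    | succ k ih =>
      intro l p hp
      have h1 := D.rotLU_mem (ih _ _ (C.rotUL_mem hp))
      have : rotLU (rotUL p) = p := by
        have e : ∀ x : Fin (k + 1) ⊕ Fin l, (Sum.elim (fun i => Sum.inl i.succ)
            (fun j => Fin.cases (Sum.inl (0 : Fin (k + 1))) (fun j' => Sum.inr j') j) :
              Fin k ⊕ Fin (l + 1) → Fin (k + 1) ⊕ Fin l) ((Sum.elim (fun i => Fin.cases (Sum.inr (0 : Fin (l + 1))) (fun i' => Sum.inl i') i)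
      (fun j => Sum.inr j.succ) : Fin (k + 1) ⊕ Fin l → Fin k ⊕ Fin (l + 1)) x) = x := by
          rintro (i | i)
          · refine Fin.cases ?_ (fun j => ?_) i <;> simp
          · simp
        apply Setoid.ext
        intro x y
        exact iff_of_eq (congrArg₂ (fun a b => p a b) (e x) (e y))
      rwa [this] at h1
  rintro ⟨k, l, p⟩ hp
  exact key k l p hp

/-- The category generated by a set. -/
def genCat (S : Set (Σ k l : ℕ, Partition k l)) : PartitionCategory where
  mem := generated S
  id_mem := fun C _ => C.id_mem
  tensor_mem := fun h1 h2 C hC => C.tensor_mem (h1 C hC) (h2 C hC)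
  comp_mem := fun h1 h2 C hC => C.comp_mem (h1 C hC) (h2 C hC)
  involution_mem := fun h1 C hC => C.involution_mem (h1 C hC)
  rotUL_mem := fun h1 C hC => C.rotUL_mem (h1 C hC)
  rotLU_mem := fun h1 C hC => C.rotLU_mem (h1 C hC)
  rotUR_mem := fun h1 C hC => C.rotUR_mem (h1 C hC)
  rotRU_mem := fun h1 C hC => C.rotRU_mem (h1 C hC)

/-- The word of `π_k` built from a word `g`. -/
def piW (g : List ℕ) : List ℕ := g ++ g.reverse ++ g ++ g.reverse

theorem Wd_pi (C : PartitionCategory) (l : ℕ) :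
    Wd C (piW (List.range l)) ↔
      (⟨0, 4 * l, piPartition l⟩ : Σ k l : ℕ, Partition k l) ∈ C.mem := by
  unfold piPartition ofWord
  refine Wd_iff C _ _ _ (by simp [piW]; omega) ?_
  intro i h1 h2
  simp only [piW, List.getElem_append, List.length_append, List.length_range, List.length_reverse,
    List.getElem_range, List.getElem_reverse]
  have hh : i % (2 * l) = if i < 2 * l then i else i - 2 * l := by
    split_ifs with h
    · exact Nat.mod_eq_of_lt h
    · rw [Nat.mod_eq_sub_mod (by omega), Nat.mod_eq_of_lt (by omega)]
  rw [hh]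
  clear hh h1
  split_ifs <;> omega

theorem Wd_four (C : PartitionCategory) :
    Wd C [0, 0, 0, 0] ↔ (⟨0, 4, fourBlock⟩ : Σ k l : ℕ, Partition k l) ∈ C.mem := by
  have : fourBlock = Setoid.ker (Sum.elim (Fin.elim0 : Fin 0 → ℕ) (List.get [0, 0, 0, 0])) := by
    apply Setoid.ext
    rintro (a | a) (b | b)
    · exact a.elim0
    · exact a.elim0
    · exact b.elim0
    · simp only [Setoid.ker_def, Sum.elim_inr]
      refine ⟨fun _ => ?_, fun _ => trivial⟩
      fin_cases a <;> fin_cases b <;> rfl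
  rw [this]; rfl

theorem Wd_double (C : PartitionCategory) :
    Wd C [0, 1] ↔ (⟨0, 2, doubleSingleton⟩ : Σ k l : ℕ, Partition k l) ∈ C.mem := by
  have : doubleSingleton = Setoid.ker (Sum.elim (Fin.elim0 : Fin 0 → ℕ) (List.get [0, 1])) := by
    apply Setoid.ext
    rintro (a | a) (b | b)
    · exact a.elim0
    · exact a.elim0
    · exact b.elim0
    · simp only [Setoid.ker_def, Sum.elim_inr]
      change Sum.inr a = Sum.inr b ↔ _
      rw [Sum.inr.injEq]
      revert a b; decide
  rw [this]; rfl

theorem Wd_positioner (C : PartitionCategory) (h : Wd C [1, 0, 0, 1, 0, 0]) :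
    (⟨3, 3, pairPositioner⟩ : Σ k l : ℕ, Partition k l) ∈ C.mem := by
  have h1 := LM_rotLU C _ _ (LM_rotLU C _ _ (LM_rotLU C _ _ h))
  have e : pairPositioner = Setoid.ker (Sum.elim
      (Fin.cons ([1, 0, 0, 1, 0, 0].get (Fin.succ 0).succ)
              (Fin.cons ([1, 0, 0, 1, 0, 0].get (Fin.succ 0)) (Fin.cons ([1, 0, 0, 1, 0, 0].get 0) Fin.elim0)) : Fin 3 → ℕ)
      (fun i : Fin 3 => [1, 0, 0, 1, 0, 0].get i.succ.succ.succ)) := by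
    apply Setoid.ext
    unfold pairPositioner
    simp only [Setoid.ker_def]
    rintro (a | a) (b | b) <;> revert a b <;> decide
  rw [e]
  exact h1


/-- Replace the letter `y` by `x`. -/
def sub (y x : ℕ) : ℕ → ℕ := fun t => if t = y then x else t

theorem sub_self (x : ℕ) : sub x x = id := by
  funext t; simp only [sub, id]; split_ifs with h <;> simp [h]

theorem map_sub_fresh (d x : ℕ) (l : List ℕ) (h : d ∉ l) : l.map (sub d x) = l := by
  conv_rhs => rw [← List.map_id l]
  apply List.map_congr_left
  intro t ht
  simp only [sub, id]
  rw [if_neg]; rintro rfl; exact h ht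

theorem exists_fresh (l : List ℕ) : ∃ d, d ∉ l := by
  obtain ⟨d, hd⟩ := Infinite.exists_notMem_finset l.toFinset
  exact ⟨d, by simpa using hd⟩

namespace WordCat

variable {W : List ℕ → Prop} (hW : WordCat W)

theorem rotate (hW : WordCat W) (u v : List ℕ) (h : W (u ++ v)) : W (v ++ u) := by
  induction u generalizing v with
  | nil => simpa using h
  | cons a u ih =>
    have h1 := hW.rot a (u ++ v) h
    rw [List.append_assoc] at h1
    have := ih _ h1
    simpa using this

theorem con2 (hW : WordCat W) (Y Z : List ℕ) (x y : ℕ) (h : W (Y ++ x :: y :: Z)) :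
    W ((Y ++ Z).map (sub y x)) := by
  have h1 := hW.con x y (Z ++ Y) (by simpa using hW.rotate _ _ h)
  rw [List.map_append] at h1
  have := hW.rotate _ _ h1
  rw [← List.map_append] at this
  exact this

theorem swap_sub (x y : ℕ) : (fun t => Equiv.swap x y (sub y x t)) = sub x y := by
  funext t
  simp only [sub]
  split_ifs with h1 h2 h2
  · simp
  · rw [h1]; simp
  · rw [h2]; simp
  · rw [Equiv.swap_apply_of_ne_of_ne h2 h1]

theorem ren_inj (hW : WordCat W) (w : List ℕ) (f : ℕ → ℕ) (hf : Function.Injective f) (h : W w) :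
    W (w.map f) := hW.ren w f (fun _ _ _ _ h => hf h) h

theorem con1 (hW : WordCat W) (Y Z : List ℕ) (x y : ℕ) (h : W (Y ++ x :: y :: Z)) :
    W ((Y ++ Z).map (sub x y)) := by
  have h1 := hW.ren_inj _ (Equiv.swap x y) (Equiv.injective _) (hW.con2 Y Z x y h)
  rw [List.map_map] at h1
  rw [← swap_sub]; exact h1

theorem con_eq (hW : WordCat W) (Y Z : List ℕ) (x : ℕ) (h : W (Y ++ x :: x :: Z)) :
    W (Y ++ Z) := by
  have := hW.con2 Y Z x x h
  rwa [sub_self, List.map_id] at this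

theorem ins (hW : WordCat W) (Y Z v : List ℕ) (h : W (Y ++ Z)) (hv : W v)
    (hd : ∀ x ∈ v, x ∉ Y ∧ x ∉ Z) : W (Y ++ (v ++ Z)) := by
  have h1 := hW.ten (Z ++ Y) v (hW.rotate _ _ h) hv (by
    intro x hx hxv
    rcases List.mem_append.1 hx with h | h
    · exact (hd x hxv).2 h
    · exact (hd x hxv).1 h)
  rw [List.append_assoc] at h1
  have := hW.rotate _ _ h1
  simpa using this

theorem pr (hW : WordCat W) (z : ℕ) : W [z, z] :=
  hW.ren [0, 0] (fun _ => z) (by simp) hW.pair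

theorem nil (hW : WordCat W) : W [] := hW.con_eq [] [] 0 hW.pair

theorem four (hW : WordCat W) (h4 : W [0, 0, 0, 0]) (z : ℕ) : W [z, z, z, z] :=
  hW.ren [0, 0, 0, 0] (fun _ => z) (by simp) h4

theorem insp (hW : WordCat W) (Y Z : List ℕ) (z : ℕ) (h : W (Y ++ Z)) (h1 : z ∉ Y) (h2 : z ∉ Z) :
    W (Y ++ z :: z :: Z) :=
  hW.ins Y Z [z, z] h (hW.pr z) (by simp [h1, h2])

theorem merge2 (hW : WordCat W) (h4 : W [0, 0, 0, 0]) (Y Z : List ℕ) (x y : ℕ)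
    (h : W (Y ++ x :: y :: Z)) : W ((Y ++ x :: y :: Z).map (sub y x)) := by
  obtain ⟨d, hd⟩ := exists_fresh (Y ++ x :: y :: Z)
  simp only [List.mem_append, List.mem_cons, not_or] at hd
  obtain ⟨hY, hx, hy, hZ⟩ := hd
  have h1 := hW.ins (Y ++ [x]) (y :: Z) [d, d, d, d] (by simpa using h) (hW.four h4 d)
    (by simp [hY, hx, hy, hZ])
  have h2 := hW.con2 Y (d :: d :: d :: y :: Z) x d (by simpa using h1)
  have h3 : W (Y ++ [x, x] ++ x :: y :: Z) := by
    simp only [List.map_append, List.map_cons, map_sub_fresh d x Y hY, map_sub_fresh d x Z hZ] at h2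
    simpa [sub, Ne.symm hy] using h2
  have h4 := hW.con2 _ _ _ _ h3
  simp only [List.map_append, List.map_cons] at h4 ⊢
  simpa [sub] using h4

theorem merge1 (hW : WordCat W) (h4 : W [0, 0, 0, 0]) (Y Z : List ℕ) (x y : ℕ)
    (h : W (Y ++ x :: y :: Z)) : W ((Y ++ x :: y :: Z).map (sub x y)) := by
  have h1 := hW.ren_inj _ (Equiv.swap x y) (Equiv.injective _) (hW.merge2 h4 Y Z x y h)
  rw [List.map_map] at h1
  rw [← swap_sub]; exact h1

end WordCat

theorem count_sub (b c d : ℕ) (hc : b ≠ c) (hd : b ≠ d) (l : List ℕ) :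
    (l.map (sub c d)).count b = l.count b := by
  induction l with
  | nil => rfl
  | cons t l ih =>
    simp only [List.map_cons, List.count_cons, ih, sub]
    by_cases h : t = c
    · subst h; simp [Ne.symm hc, Ne.symm hd]
    · simp [h]

theorem count_sub_add (c d : ℕ) (hcd : c ≠ d) (l : List ℕ) :
    (l.map (sub c d)).count d = l.count d + l.count c := by
  induction l with
  | nil => rfl
  | cons t l ih =>
    simp only [List.map_cons, List.count_cons, ih, sub]
    by_cases h : t = c
    · subst h; simp [hcd]; omega
    · simp [h]; omega

theorem card_sub (c d : ℕ) (hcd : c ≠ d) (l : List ℕ) (hc : c ∈ l) (hd : d ∈ l) :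
    (l.map (sub c d)).toFinset.card < l.toFinset.card := by
  apply Finset.card_lt_card
  rw [Finset.ssubset_iff_of_subset]
  · refine ⟨c, by simpa using hc, ?_⟩
    simp only [List.mem_toFinset, List.mem_map, not_exists, not_and, sub]
    intro t _
    split_ifs with h
    · exact hcd.symm
    · exact h
  · intro t
    simp only [List.mem_toFinset, List.mem_map, sub]
    rintro ⟨s, hs, rfl⟩
    split_ifs
    · exact hd
    · exact hs

theorem card_mono {l m : List ℕ} (h : l ⊆ m) : l.toFinset.card ≤ m.toFinset.card :=
  Finset.card_le_card (fun t ht => List.mem_toFinset.2 (h (List.mem_toFinset.1 ht)))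

/-- The alternating word `a b a b …` of length `n`. -/
def altW : ℕ → ℕ → ℕ → List ℕ
  | _, _, 0 => []
  | a, b, n + 1 => a :: altW b a n

theorem altW_length (a b n : ℕ) : (altW a b n).length = n := by
  induction n generalizing a b with
  | zero => rfl
  | succ n ih => simp [altW, ih]

theorem altW_map (f : ℕ → ℕ) (a b n : ℕ) : (altW a b n).map f = altW (f a) (f b) n := by
  induction n generalizing a b with
  | zero => rfl
  | succ n ih => simp [altW, ih]

theorem altW_mem {a b n t : ℕ} (h : t ∈ altW a b n) : t = a ∨ t = b := by
  induction n generalizing a b with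
  | zero => simp [altW] at h
  | succ n ih =>
    simp only [altW, List.mem_cons] at h
    rcases h with h | h
    · exact Or.inl h
    · exact (ih h).symm

theorem altW_app (a b k : ℕ) : altW a b (2 * k + 3) = altW a b (2 * k + 1) ++ [b, a] := by
  induction k with
  | zero => rfl
  | succ k ih =>
    have e1 : altW a b (2 * (k + 1) + 3) = a :: b :: altW a b (2 * k + 3) := rfl
    have e2 : altW a b (2 * (k + 1) + 1) = a :: b :: altW a b (2 * k + 1) := rfl
    rw [e1, e2, ih]; rfl

theorem altW_rev (a b k : ℕ) : (altW a b (2 * k + 1)).reverse = altW a b (2 * k + 1) := by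
  induction k with
  | zero => rfl
  | succ k ih =>
    have e2 : altW a b (2 * (k + 1) + 1) = a :: b :: altW a b (2 * k + 1) := rfl
    have e3 := altW_app a b k
    have e4 : altW a b (2 * (k + 1) + 1) = altW a b (2 * k + 3) := rfl
    conv_rhs => rw [e4, e3]
    rw [e2]; simp [ih]

theorem alt_of_chain (l : List ℕ) (a b : ℕ) (h : ∀ t ∈ l, t = a ∨ t = b)
    (hc : List.IsChain (· ≠ ·) (a :: l)) : l = altW b a l.length := by
  induction l generalizing a b with
  | nil => rfl
  | cons c l ih =>
    rw [List.isChain_cons_cons] at hc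
    have hcb : c = b := by
      rcases h c (by simp) with h | h
      · exact absurd h.symm hc.1
      · exact h
    subst hcb
    have := ih c a (fun t ht => (h t (by simp [ht])).symm) hc.2
    simp only [List.length_cons, altW]
    rw [← this]

theorem chain_or (l : List ℕ) :
    List.IsChain (· ≠ ·) l ∨ ∃ Y t Z, l = Y ++ t :: t :: Z := by
  induction l with
  | nil => left; simp
  | cons a l ih =>
    rcases ih with h | ⟨Y, t, Z, rfl⟩
    · cases l with
      | nil => left; simp
      | cons b l =>
        by_cases hab : a = b
        · right; exact ⟨[], a, l, by simp [hab]⟩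
        · left; rw [List.isChain_cons_cons]; exact ⟨hab, h⟩
    · right; exact ⟨a :: Y, t, Z, rfl⟩

namespace WordCat

variable {W : List ℕ → Prop}

theorem cancel (hW : WordCat W) (t Y Z : List ℕ) (h : W (Y ++ (t ++ (t.reverse ++ Z)))) :
    W (Y ++ Z) := by
  induction t generalizing Y Z with
  | nil => simpa using h
  | cons x t ih =>
    have := ih (Y ++ [x]) (x :: Z) (by simpa using h)
    exact hW.con_eq Y Z x (by simpa using this)

theorem cancel' (hW : WordCat W) (t Y Z : List ℕ) (h : W (Y ++ (t.reverse ++ (t ++ Z)))) :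
    W (Y ++ Z) :=
  hW.cancel t.reverse Y Z (by simpa using h)

theorem no_two (hW : WordCat W) (h2 : ¬ W [0, 1]) (a b : ℕ) (hab : a ≠ b) : ¬ W [a, b] := by
  intro h
  refine h2 ?_
  have := hW.ren [a, b] (fun t => if t = a then 0 else 1) (by simp [hab, Ne.symm hab]) h
  simpa [Ne.symm hab] using this

theorem no_pos (hW : WordCat W) (hp : ¬ W [1, 0, 0, 1, 0, 0]) (b a : ℕ) (hab : a ≠ b) :
    ¬ W [b, a, a, b, a, a] := by
  intro h
  refine hp ?_
  have := hW.ren _ (fun t => if t = a then 0 else 1) (by simp [hab, Ne.symm hab]) h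
  simpa [Ne.symm hab] using this

theorem no_odd (hW : WordCat W) (h2 : ¬ W [0, 1]) (n : ℕ) :
    ∀ w : List ℕ, w.length = 2 * n + 1 → ¬ W w := by
  induction n with
  | zero =>
    intro w hw h
    obtain ⟨a, rfl⟩ := List.length_eq_one_iff.1 hw
    have h1 : W [a + 1] := hW.ren [a] (fun t => t + 1) (by simp) h
    exact hW.no_two h2 a (a + 1) (by simp) (hW.ten _ _ h h1 (by simp))
  | succ n ih =>
    intro w hw h
    match w, hw with
    | x :: y :: Z, hw =>
      refine ih _ ?_ (hW.con2 [] Z x y h)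
      simp at hw ⊢; omega

theorem no_alt (hW : WordCat W) (h4 : W [0, 0, 0, 0])
    (hp : ¬ W [1, 0, 0, 1, 0, 0]) (x b : ℕ) (hxb : x ≠ b) (m : ℕ) :
    ¬ W (altW x b (2 * m + 4)) := by
  intro h
  obtain ⟨N, hx, hb⟩ : ∃ N, x < N ∧ b < N := ⟨x + b + 1, by omega, by omega⟩
  have hv : W (altW N (N + 1) (2 * m + 4)) := by
    have := hW.ren (altW x b (2 * m + 4)) (fun t => if t = x then N else N + 1) (by
      intro t ht s hs
      rcases altW_mem ht with rfl | rfl <;> rcases altW_mem hs with rfl | rfl <;>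
        simp [hxb, Ne.symm hxb]) h
    rw [altW_map] at this
    simpa [Ne.symm hxb] using this
  have h1 := hW.ins [x, b, x] (altW b x (2 * m + 1)) (altW N (N + 1) (2 * m + 4)) h hv (by
    intro t ht
    have : N ≤ t := by rcases altW_mem ht with rfl | rfl <;> omega
    constructor
    · simp; omega
    · intro h; rcases altW_mem h with rfl | rfl <;> omega)
  have h2 := hW.con2 [x, b] ((N + 1) :: (altW N (N + 1) (2 * m + 2) ++ altW b x (2 * m + 1)))
    x N (by simpa [altW] using h1)
  simp only [List.map_append, List.map_cons, altW_map, List.map_nil] at h2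
  have e1 : sub N x x = x := by simp [sub]
  have e2 : sub N x b = b := by simp [sub]; omega
  have e3 : sub N x N = x := by simp [sub]
  have e4 : sub N x (N + 1) = N + 1 := by simp [sub]
  rw [e1, e2, e3, e4] at h2
  cases m with
  | zero =>
    have h3 := hW.merge2 h4 [x] [x, N + 1, b] b (N + 1) (by simpa [altW] using h2)
    refine hW.no_pos hp x b hxb.symm ?_
    have e5 : ¬ x = N + 1 := by omega
    have e6 : ¬ b = N + 1 := by omega
    simpa [sub, e5, e6] using h3
  | succ k =>
    have h3 := hW.con2 [x] (altW x (N + 1) (2 * k + 4) ++ altW b x (2 * k + 3)) b (N + 1)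
      h2
    simp only [List.map_append, List.map_cons, altW_map, List.map_nil] at h3
    have f1 : sub (N + 1) b x = x := by simp [sub]; omega
    have f2 : sub (N + 1) b b = b := by simp [sub]
    have f4 : sub (N + 1) b (N + 1) = b := by simp [sub]
    rw [f1, f2, f4, altW_app] at h3
    have h5 := hW.cancel (altW b x (2 * k + 1)) [x, x, b, x] [x, b] (by
      rw [altW_rev]; simpa [altW] using h3)
    have h6 := hW.rotate [x, x, b] [x, x, b] h5
    exact hW.no_pos hp b x hxb (hW.rotate [x, x] [b, x, x, b] h6)

theorem viol (hW : WordCat W) (h4 : W [0, 0, 0, 0]) (h2 : ¬ W [0, 1])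
    (hp : ¬ W [1, 0, 0, 1, 0, 0]) (n : ℕ) : ∀ (a b : ℕ) (X Z : List ℕ), a ≠ b →
      Odd (X.count b) →
      (a :: (X ++ a :: Z)).length + (a :: (X ++ a :: Z)).toFinset.card + X.length < n →
      ¬ W (a :: (X ++ a :: Z)) := by
  induction n with
  | zero => intros; omega
  | succ n ih =>
  intro a b X Z hab hodd hn h
  match X with
  | [] => simp at hodd
  | x :: X1 =>
  by_cases hxa : x = a
  · subst hxa
    have h1 := hW.rotate [x] (x :: (X1 ++ x :: Z)) (by simpa using h)
    refine ih x b X1 (Z ++ [x]) hab ?_ ?_ (by simpa using h1)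
    · simpa [List.count_cons, hab] using hodd
    · have hc : (x :: (X1 ++ x :: (Z ++ [x]))).toFinset.card ≤
          (x :: ((x :: X1) ++ x :: Z)).toFinset.card := by
        apply card_mono; intro t; simp
        tauto
      simp only [List.length_cons, List.length_append, List.length_nil] at hn ⊢
      omega
  by_cases hxb : x = b
  · subst hxb
    match X1 with
    | [] =>
      simp only [List.singleton_append] at h hn
      by_cases hc : ∃ c ∈ Z, c ≠ a ∧ c ≠ x
      · obtain ⟨c, hcZ, hca, hcx⟩ := hc
        obtain ⟨Z1, Z2, rfl, hc1⟩ := List.eq_append_cons_of_mem hcZ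
        obtain ⟨Q, d, hQ⟩ : ∃ Q d, a :: x :: a :: Z1 = Q ++ [d] :=
          ⟨_, _, (List.dropLast_append_getLast (List.cons_ne_nil _ _)).symm⟩
        have hd : d ∈ a :: x :: a :: Z1 := by rw [hQ]; simp
        have hdc : c ≠ d := by
          rintro rfl
          simp [hca, hcx, hc1] at hd
        have e : a :: x :: a :: (Z1 ++ c :: Z2) = Q ++ d :: c :: Z2 := by
          have : a :: x :: a :: (Z1 ++ c :: Z2) = (a :: x :: a :: Z1) ++ c :: Z2 := by simp
          rw [this, hQ]; simp
        have h1 := hW.merge2 h4 Q Z2 d c (by rw [← e]; exact h)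
        rw [← e] at h1
        have hcard := card_sub c d hdc (a :: x :: a :: (Z1 ++ c :: Z2)) (by simp)
          (by simp at hd ⊢; tauto)
        have ea : sub c d a = a := by simp [sub, Ne.symm hca]
        have ex : sub c d x = x := by simp [sub, Ne.symm hcx]
        have hlen : ((Z1 ++ c :: Z2).map (sub c d)).length = (Z1 ++ c :: Z2).length := by simp
        simp only [List.map_cons, ea, ex] at h1 hcard
        refine ih a x [x] _ hab (by simp) ?_ h1
        simp only [List.singleton_append, List.length_cons, List.length_nil] at hn hcard ⊢
        omega
      · push Not at hc
        have hZ : ∀ t ∈ Z, t = a ∨ t = x := by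
          intro t ht
          by_cases hta : t = a
          · exact Or.inl hta
          · exact Or.inr (hc t ht hta)
        rcases chain_or Z with hch | ⟨Y, t, Z2, rfl⟩
        · have hlen : Even (a :: x :: a :: Z).length := by
            by_contra ho
            rw [Nat.not_even_iff_odd] at ho
            obtain ⟨k, hk⟩ := ho
            exact hW.no_odd h2 k _ hk h
          simp only [List.length_cons] at hlen
          match Z, hch, hZ with
          | [], _, _ => simp at hlen; exact absurd hlen (by decide)
          | z :: Z', hch, hZ =>
            rcases hZ z (by simp) with rfl | rfl
            · have he := alt_of_chain Z' z x (fun t ht => hZ t (by simp [ht])) hch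
              generalize hm : Z'.length = m at he
              match m with
              | 0 =>
                subst he
                exact hW.no_two h2 _ _ hab (hW.con_eq [z, x] [] z h)
              | 1 => simp [hm] at hlen; exact absurd hlen (by decide)
              | 2 =>
                subst he
                exact hW.no_pos hp x z hab (hW.rotate [z] [x, z, z, x, z] h)
              | 3 => simp [hm] at hlen; exact absurd hlen (by decide)
              | m + 4 =>
                have h1 := hW.con_eq [z, x] (x :: z :: x :: z :: altW x z m) z
                  (by rw [he] at h; simpa [altW] using h)
                have h3 := hW.rotate [z, x, x] (z :: x :: z :: altW x z m) (by simpa using h1)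
                refine ih z x [x] (altW x z m ++ [z, x, x]) hab (by simp) ?_ (by simpa using h3)
                have hcard : (z :: ([x] ++ z :: (altW x z m ++ [z, x, x]))).toFinset.card ≤
                    (z :: x :: z :: z :: Z').toFinset.card := by
                  apply card_mono; intro t ht
                  simp at ht ⊢
                  have hh : t = z ∨ t = x := by
                    rcases ht with h | h | h | h
                    · exact Or.inl h
                    · exact Or.inr h
                    · exact Or.inl h
                    · rcases h with h | h | h
                      · exact (altW_mem h).symm
                      · exact Or.inl h
                      · exact Or.inr h
                  rcases hh with h | h <;> simp [h]
                simp only [List.length_cons, List.length_nil, List.length_append, altW_length] at hn hcard ⊢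
                omega
            · have he := alt_of_chain Z' z a (fun t ht => (hZ t (by simp [ht])).symm) hch
              simp only [List.length_cons] at hlen
              obtain ⟨k, hk⟩ := hlen
              have : Z'.length = 2 * (k - 2) := by omega
              rw [this] at he
              refine hW.no_alt h4 hp a z hab (k - 2) ?_
              rw [he] at h
              simpa [altW] using h
        · have h1 := hW.con_eq (a :: x :: a :: Y) Z2 t (by simpa using h)
          refine ih a x [x] (Y ++ Z2) hab (by simp) ?_ (by simpa using h1)
          have hcard : (a :: ([x] ++ a :: (Y ++ Z2))).toFinset.card ≤
              (a :: x :: a :: (Y ++ t :: t :: Z2)).toFinset.card := by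
            apply card_mono; intro t; simp; tauto
          simp only [List.length_cons, List.length_nil, List.length_append] at hn hcard ⊢
          omega
    | y :: X2 =>
      by_cases hya : y = a
      · subst hya
        refine ih y x [x] (X2 ++ y :: Z) hab (by simp) ?_ (by simpa using h)
        simp only [List.length_cons, List.length_nil, List.length_append, List.cons_append, List.nil_append] at hn ⊢
        omega
      by_cases hyx : y = x
      · subst hyx
        have h1 := hW.con_eq [a] (X2 ++ a :: Z) y (by simpa using h)
        refine ih a y X2 Z hab ?_ ?_ (by simpa using h1)
        · simp [List.count_cons] at hodd
          rwa [add_assoc, Nat.odd_add, iff_true_right (by decide)] at hodd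
        · have hcard : (a :: (X2 ++ a :: Z)).toFinset.card ≤
              (a :: (y :: y :: X2 ++ a :: Z)).toFinset.card := by
            apply card_mono; intro t; simp; tauto
          simp only [List.length_cons, List.length_append] at hn hcard ⊢
          omega
      by_cases hcy : Odd ((x :: y :: X2).count y)
      · have h1 := hW.merge2 h4 [] (y :: X2 ++ a :: Z) a x (by simpa using h)
        have hcard := card_sub x a hab.symm (a :: (x :: y :: X2 ++ a :: Z)) (by simp) (by simp)
        have ea : sub x a a = a := by simp [sub]
        have hl : ((x :: y :: X2).map (sub x a)).length = (x :: y :: X2).length := by simp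
        refine ih a y ((x :: y :: X2).map (sub x a)) (Z.map (sub x a)) (Ne.symm hya) ?_ ?_ ?_
        · rwa [count_sub _ _ _ hyx hya]
        · have : a :: (List.map (sub x a) (x :: y :: X2) ++ a :: Z.map (sub x a)) =
            (a :: (x :: y :: X2 ++ a :: Z)).map (sub x a) := by simp [ea]
          rw [this, hl, List.length_map]
          omega
        · simpa [ea] using h1
      · rw [Nat.not_odd_iff_even] at hcy
        have h1 := hW.merge2 h4 [a] (X2 ++ a :: Z) x y (by simpa using h)
        have hcard := card_sub y x hyx (a :: (x :: y :: X2 ++ a :: Z)) (by simp) (by simp)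
        have ea : sub y x a = a := by simp [sub, Ne.symm hya]
        have hl : ((x :: y :: X2).map (sub y x)).length = (x :: y :: X2).length := by simp
        refine ih a x ((x :: y :: X2).map (sub y x)) (Z.map (sub y x)) hab ?_ ?_ ?_
        · rw [count_sub_add _ _ hyx]
          exact hodd.add_even hcy
        · have : a :: (List.map (sub y x) (x :: y :: X2) ++ a :: Z.map (sub y x)) =
            (a :: (x :: y :: X2 ++ a :: Z)).map (sub y x) := by simp [ea]
          rw [this, hl, List.length_map]
          omega
        · simpa [ea] using h1
  · have h1 := hW.merge2 h4 [] (X1 ++ a :: Z) a x (by simpa using h)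
    have hcard := card_sub x a hxa (a :: (x :: X1 ++ a :: Z)) (by simp) (by simp)
    have ea : sub x a a = a := by simp [sub, Ne.symm hxa]
    have hl : ((x :: X1).map (sub x a)).length = (x :: X1).length := by simp
    refine ih a b ((x :: X1).map (sub x a)) (Z.map (sub x a)) hab ?_ ?_ ?_
    · rwa [count_sub _ _ _ (Ne.symm hxb) (Ne.symm hab)]
    · have : a :: (List.map (sub x a) (x :: X1) ++ a :: Z.map (sub x a)) =
        (a :: (x :: X1 ++ a :: Z)).map (sub x a) := by simp [ea]
      rw [this, hl, List.length_map]
      omega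
    · simpa [ea] using h1

end WordCat

/-- The two parity properties of words in non-group-theoretical hyperoctahedral categories. -/
structure Good (W : List ℕ → Prop) : Prop extends WordCat W where
  sep : ∀ (a b : ℕ) (Y X Z : List ℕ), a ≠ b → W (Y ++ a :: (X ++ a :: Z)) → Even (X.count b)
  even : ∀ (a : ℕ) (w : List ℕ), W w → Even (w.count a)
  four : W [0, 0, 0, 0]

theorem WordCat.good {W : List ℕ → Prop} (hW : WordCat W) (h4 : W [0, 0, 0, 0])
    (h2 : ¬ W [0, 1]) (hp : ¬ W [1, 0, 0, 1, 0, 0]) : Good W := by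
  have sep : ∀ (a b : ℕ) (Y X Z : List ℕ), a ≠ b → W (Y ++ a :: (X ++ a :: Z)) →
      Even (X.count b) := by
    intro a b Y X Z hab h
    by_contra ho
    rw [Nat.not_even_iff_odd] at ho
    have h1 := hW.rotate _ _ h
    exact hW.viol h4 h2 hp _ a b X (Z ++ Y) hab ho (Nat.lt_succ_self _) (by simpa using h1)
  refine ⟨hW, sep, ?_, h4⟩
  intro a w hw
  obtain ⟨p, hpw⟩ := exists_fresh (a :: w)
  simp at hpw
  have h1 := hW.ins [p] [p] w (hW.pr p) hw (by
    intro x hx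
    have : x ≠ p := by rintro rfl; exact hpw.2 hx
    simp [this])
  exact sep p a [] w [] hpw.1 (by simpa using h1)

/-- One step of the stack reduction of a word. -/
def step (s : List ℕ) (x : ℕ) : List ℕ :=
  match s with
  | [] => [x]
  | y :: s' => if y = x then s' else x :: y :: s'

/-- Stack reduction of a word. -/
def run (s X : List ℕ) : List ℕ := X.foldl step s

theorem run_nil (s : List ℕ) : run s [] = s := rfl
theorem run_cons (s X : List ℕ) (x : ℕ) : run s (x :: X) = run (step s x) X := rfl
theorem run_append (s X Y : List ℕ) : run s (X ++ Y) = run (run s X) Y := by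
  simp [run]

theorem step_cases (s : List ℕ) (x : ℕ) :
    (∃ s', s = x :: s' ∧ step s x = s') ∨ (step s x = x :: s ∧ s.head? ≠ some x) := by
  cases s with
  | nil => right; simp [step]
  | cons y s =>
    by_cases h : y = x
    · left; exact ⟨s, by rw [h], by simp [step, h]⟩
    · right; simp [step, h]

theorem step_chain (s : List ℕ) (x : ℕ) (h : List.IsChain (· ≠ ·) s) :
    List.IsChain (· ≠ ·) (step s x) := by
  cases s with
  | nil => simp [step]
  | cons y s =>
    by_cases hy : y = x
    · simp only [step, hy, if_true]; exact h.tail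
    · simp only [step, hy, if_false]
      rw [List.isChain_cons_cons]; exact ⟨Ne.symm hy, h⟩

theorem run_chain (s X : List ℕ) (h : List.IsChain (· ≠ ·) s) :
    List.IsChain (· ≠ ·) (run s X) := by
  induction X generalizing s with
  | nil => exact h
  | cons x X ih => exact ih _ (step_chain s x h)

theorem step_step (s : List ℕ) (x : ℕ) (h : List.IsChain (· ≠ ·) s) :
    step (step s x) x = s := by
  cases s with
  | nil => simp [step]
  | cons y s =>
    by_cases hy : y = x
    · subst hy
      have e : step (y :: s) y = s := by simp [step]
      rw [e]
      cases s with
      | nil => rfl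
      | cons z s =>
        rw [List.isChain_cons_cons] at h
        simp [step, Ne.symm h.1]
    · have e : step (y :: s) x = x :: y :: s := by simp [step, hy]
      rw [e]; simp [step]

theorem run_rev (s t X : List ℕ) (h : List.IsChain (· ≠ ·) s) :
    run s (t.reverse ++ X) = run s (run t X).reverse := by
  induction X generalizing t with
  | nil => simp [run_nil]
  | cons x X ih =>
    rw [run_cons, ← ih]
    rcases step_cases t x with ⟨t', rfl, e⟩ | ⟨e, _⟩
    · rw [e]
      have : (x :: t').reverse ++ x :: X = t'.reverse ++ (x :: x :: X) := by simp
      rw [this, run_append, run_append, run_cons, run_cons, step_step _ _ (run_chain _ _ h)]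
    · rw [e]; simp

theorem run_closed (s X : List ℕ) (h : List.IsChain (· ≠ ·) s) (hX : run [] X = []) :
    run s X = s := by
  have := run_rev s [] X h
  simpa [hX, run_nil] using this

theorem count_run (b : ℕ) (s X : List ℕ) :
    (run s X).count b % 2 = (s.count b + X.count b) % 2 := by
  induction X generalizing s with
  | nil => simp [run_nil]
  | cons x X ih =>
    rw [run_cons, ih]
    rcases step_cases s x with ⟨t', rfl, e⟩ | ⟨e, _⟩ <;> rw [e] <;>
      simp only [List.count_cons] <;> split_ifs <;> omega

theorem run_bot (s U : List ℕ) (a : ℕ) (h : a ∉ U) : run (s ++ [a]) U = run s U ++ [a] := by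
  induction U generalizing s with
  | nil => rfl
  | cons x U ih =>
    simp only [List.mem_cons, not_or] at h
    have e : step (s ++ [a]) x = step s x ++ [a] := by
      cases s with
      | nil => simp [step, h.1]
      | cons y s => by_cases hy : y = x <;> simp [step, hy]
    rw [run_cons, run_cons, e, ih _ h.2]

theorem WordCat.runW {W : List ℕ → Prop} (hW : WordCat W) (X s Y Z : List ℕ)
    (h : W (Y ++ (s.reverse ++ (X ++ Z)))) : W (Y ++ ((run s X).reverse ++ Z)) := by
  induction X generalizing s with
  | nil => exact h
  | cons x X ih =>
    rw [run_cons]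
    apply ih
    rcases step_cases s x with ⟨t', rfl, e⟩ | ⟨e, _⟩
    · rw [e]
      have := hW.con_eq (Y ++ t'.reverse) (X ++ Z) x (by simpa using h)
      simpa using this
    · rw [e]; simpa using h

namespace Good

variable {W : List ℕ → Prop}

theorem no_gap (hW : Good W) (n : ℕ) : ∀ (a : ℕ) (Y X Z : List ℕ), X.length < n →
    List.IsChain (· ≠ ·) (a :: (X ++ [a])) → ¬ W (Y ++ a :: (X ++ a :: Z)) := by
  induction n with
  | zero => intros; omega
  | succ n ih =>
    intro a Y X Z hn hc h
    match X with
    | [] => simp at hc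
    | b :: X' =>
      have hab : a ≠ b := by
        simp only [List.cons_append, List.isChain_cons_cons] at hc
        exact hc.1
      have he := hW.sep a b Y _ Z hab h
      have hb : b ∈ X' := by
        by_contra hb
        rw [List.count_cons_self, List.count_eq_zero_of_not_mem hb] at he
        exact absurd he (by decide)
      obtain ⟨X1, X2, rfl⟩ := List.append_of_mem hb
      refine ih b (Y ++ [a]) X1 (X2 ++ a :: Z) ?_ ?_ (by simpa using h)
      · simp at hn ⊢; omega
      · refine List.IsChain.infix hc ⟨[a], X2 ++ [a], by simp⟩

theorem nodup (hW : Good W) (R Y Z : List ℕ) (hR : List.IsChain (· ≠ ·) R)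
    (h : W (Y ++ (R ++ Z))) : R.Nodup := by
  induction R generalizing Y with
  | nil => simp
  | cons a R ih =>
    rw [List.nodup_cons]
    refine ⟨?_, ih (Y ++ [a]) hR.tail (by simpa using h)⟩
    intro ha
    obtain ⟨X1, X2, rfl⟩ := List.append_of_mem ha
    refine hW.no_gap _ a Y X1 (X2 ++ Z) (Nat.lt_succ_self _) ?_ (by simpa using h)
    exact List.IsChain.infix hR ⟨[], X2, by simp⟩

theorem rev_eq (hW : Good W) (A : List ℕ) : ∀ (Y B Z : List ℕ), A.Nodup → B.Nodup →
    (∀ x, x ∈ A ↔ x ∈ B) → W (Y ++ (A ++ (B ++ Z))) → B = A.reverse := by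
  induction A using List.reverseRecOn with
  | nil =>
    intro Y B Z _ _ hAB _
    cases B with
    | nil => rfl
    | cons b B => exact absurd ((hAB b).2 (by simp)) (by simp)
  | append_singleton A x ih =>
    intro Y B Z hA hB hAB h
    have hx : x ∈ B := (hAB x).1 (by simp)
    obtain ⟨B1, B2, rfl⟩ := List.append_of_mem hx
    match B1 with
    | [] =>
      have h1 := hW.con_eq (Y ++ A) (B2 ++ Z) x (by simpa using h)
      have hA' := List.nodup_append.1 hA
      simp only [List.nil_append, List.nodup_cons] at hB
      have := ih Y B2 Z hA'.1 hB.2 ?_ (by simpa using h1)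
      · simp [this]
      · intro y
        have := hAB y
        by_cases hyx : y = x
        · subst hyx
          refine iff_of_false ?_ hB.1
          intro hy; exact hA'.2.2 y hy y (by simp) rfl
        · simpa [hyx] using this
    | b :: B1 =>
      exfalso
      simp only [List.cons_append, List.nodup_cons, List.mem_append, List.mem_cons, not_or] at hB
      have he := hW.sep x b (Y ++ A) (b :: B1) (B2 ++ Z) (Ne.symm hB.1.2.1) (by simpa using h)
      rw [List.count_cons_self, List.count_eq_zero_of_not_mem hB.1.1] at he
      exact absurd he (by decide)

/-- Reducing a leg. -/
theorem leg_red (hW : Good W) (Y X Z : List ℕ) (h : W (Y ++ (X ++ Z))) :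
    W (Y ++ ((run [] X).reverse ++ Z)) ∧ (run [] X).reverse.Nodup ∧
      ∀ x, x ∈ (run [] X).reverse ↔ Odd (X.count x) := by
  have h1 := hW.runW X [] Y Z (by simpa using h)
  have hc : List.IsChain (· ≠ ·) (run [] X) := run_chain [] X (by simp)
  have hc' : List.IsChain (· ≠ ·) (run [] X).reverse := by
    rw [List.isChain_reverse]
    exact hc.imp (fun _ _ h => h.symm)
  have hn := hW.nodup _ Y Z hc' h1
  refine ⟨h1, hn, fun x => ?_⟩
  have hk := count_run x [] X
  rw [List.nodup_reverse] at hn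
  rw [List.mem_reverse, Nat.odd_iff]
  simp only [List.count_nil, zero_add] at hk
  rw [← hk, hn.count]
  split_ifs with hx <;> simp [hx]

theorem closed (hW : Good W) (Y X Z : List ℕ) (h : W (Y ++ (X ++ Z)))
    (he : ∀ x, Even (X.count x)) : run [] X = [] := by
  obtain ⟨_, _, h3⟩ := hW.leg_red Y X Z h
  rw [← List.reverse_eq_nil_iff, List.eq_nil_iff_forall_not_mem]
  intro x hx
  exact (Nat.not_odd_iff_even.2 (he x)) ((h3 x).1 hx)

end Good

namespace WordCat

variable {V : List ℕ → Prop}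

theorem conL (hV : WordCat V) (f : ℕ → ℕ) (q : List ℕ) : ∀ (Y Z p : List ℕ), q.map f = p →
    (∀ t, t ∈ Z ∨ t ∈ p → t ∉ q → f t = t) → q.Nodup → (∀ t ∈ q, t ∉ Y) → (∀ t ∈ q, t ∉ p) →
    V (Y ++ (p.reverse ++ (q ++ Z))) → V (Y ++ Z.map f) := by
  induction q with
  | nil =>
    intro Y Z p hp hf _ _ _ h
    subst hp
    have : Z.map f = Z := by
      conv_rhs => rw [← List.map_id Z]
      exact List.map_congr_left (fun t ht => hf t (Or.inl ht) (by simp))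
    rw [this]; simpa using h
  | cons q0 q ih =>
    intro Y Z p hp hf hnd hY hqp h
    subst hp
    rw [List.nodup_cons] at hnd
    have h1 := hV.con2 (Y ++ (q.map f).reverse) (q ++ Z) (f q0) q0 (by simpa using h)
    simp only [List.map_append] at h1
    rw [map_sub_fresh q0 _ Y (hY q0 (by simp)), map_sub_fresh q0 _ q hnd.1, map_sub_fresh] at h1
    swap
    · have := hqp q0 (by simp)
      rw [List.map_cons, List.mem_cons, not_or] at this
      simpa using this.2
    have hp0 : f (f q0) = f q0 := by
      refine hf _ (Or.inr (by simp)) ?_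
      intro hh
      exact hqp _ hh (by simp)
    have h2 := ih Y (Z.map (sub q0 (f q0))) (q.map f) rfl ?_ hnd.2
      (fun t ht => hY t (by simp [ht])) ?_ (by simpa using h1)
    · rw [List.map_map] at h2
      have : Z.map (f ∘ sub q0 (f q0)) = Z.map f := by
        apply List.map_congr_left
        intro t _
        simp only [Function.comp, sub]
        split_ifs with h
        · rw [h, hp0]
        · rfl
      rwa [this] at h2
    · intro t ht htq
      by_cases htq0 : t = q0
      · subst htq0
        exfalso
        rcases ht with ht | ht
        · obtain ⟨z, hz, hzt⟩ := List.mem_map.1 ht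
          simp only [sub] at hzt
          split_ifs at hzt with h'
          · exact hqp t (by simp) (by simp [hzt])
          · exact h' hzt
        · exact hqp t (by simp) (by rw [List.map_cons]; exact List.mem_cons_of_mem _ ht)
      · rcases ht with ht | ht
        · obtain ⟨z, hz, hzt⟩ := List.mem_map.1 ht
          simp only [sub] at hzt
          split_ifs at hzt with h'
          · rw [← hzt, hp0]
          · subst hzt
            exact hf z (Or.inl hz) (by simp [htq0, htq])
        · exact hf t (Or.inr (by rw [List.map_cons]; exact List.mem_cons_of_mem _ ht))
            (by simp [htq0, htq])
    · intro t ht hh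
      exact hqp t (by simp [ht]) (by rw [List.map_cons]; exact List.mem_cons_of_mem _ hh)

theorem proj (hV : WordCat V) (t P Z : List ℕ) (x : ℕ)
    (hpi : V (piW (List.range (t.length + 1))))
    (h : V (P ++ (t ++ (t.reverse ++ x :: Z)))) :
    V (P ++ x :: x :: (t ++ (t.reverse ++ x :: Z))) := by
  obtain ⟨z, hz⟩ := exists_fresh (P ++ (t ++ (t.reverse ++ x :: Z)))
  simp only [List.mem_append, List.mem_reverse, List.mem_cons, not_or] at hz
  obtain ⟨hzP, hzt, -, hzx, hzZ⟩ := hz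
  have h1 := hV.insp P (t ++ (t.reverse ++ x :: Z)) z h hzP (by simp [hzt, hzx, hzZ])
  obtain ⟨N, hN⟩ : ∃ N, ∀ y ∈ P ++ z :: z :: (t ++ (t.reverse ++ x :: Z)), y < N := by
    refine ⟨(P ++ z :: z :: (t ++ (t.reverse ++ x :: Z))).sum + 1, fun y hy => ?_⟩
    exact Nat.lt_succ_of_le (List.le_sum_of_mem hy)
  have hNP : ∀ y ∈ P, y < N := fun y hy => hN y (by simp [hy])
  have hNt : ∀ y ∈ t, y < N := fun y hy => hN y (by simp [hy])
  have hNZ : ∀ y ∈ Z, y < N := fun y hy => hN y (by simp [hy])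
  have hNz : z < N := hN z (by simp)
  have hNx : x < N := hN x (by simp)
  set T := (List.range (t.length + 1)).map (fun i => i + N) with hT
  have hTN : ∀ y ∈ T, N ≤ y := by
    intro y hy
    simp only [hT, List.mem_map] at hy
    obtain ⟨i, _, rfl⟩ := hy
    omega
  have hVT : V (piW T) := by
    have := hV.ren_inj _ (fun i => i + N) (add_left_injective N) hpi
    simpa [piW, hT] using this
  have h2 := hV.ins (P ++ z :: z :: (t ++ (t.reverse ++ [x]))) Z (piW T) (by simpa using h1) hVT (by
    intro y hy
    have hy' : N ≤ y := by
      apply hTN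
      simpa [piW] using hy
    constructor
    · intro hh
      have := hN y (by simp at hh ⊢; tauto)
      omega
    · intro hh
      have := hNZ y hh
      omega)
  let f : ℕ → ℕ := fun y => if y < N then y else (x :: t).getD (y - N) 0
  have hf : ∀ y, y < N → f y = y := fun y hy => by simp [f, hy]
  have hTf : T.map f = x :: t := by
    apply List.ext_getElem
    · simp [hT]
    · intro i h1 h2
      simp [hT, f]
      rw [List.getElem?_eq_getElem h2]; simp
  have hZf : Z.map f = Z := by
    conv_rhs => rw [← List.map_id Z]
    exact List.map_congr_left (fun y hy => hf y (hNZ y hy))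
  have hTnd : T.Nodup := List.nodup_range.map (add_left_injective N)
  have h3 := hV.conL f T (P ++ z :: z :: t) (T.reverse ++ (T ++ (T.reverse ++ Z))) (x :: t) hTf
    (by
      intro y hy hyT
      apply hf
      simp only [List.mem_append, List.mem_reverse, List.mem_cons] at hy
      rcases hy with (hy | hy | hy | hy) | hy | hy
      · exact absurd hy hyT
      · exact absurd hy hyT
      · exact absurd hy hyT
      · exact hNZ y hy
      · rw [hy]; exact hNx
      · exact hNt y hy) hTnd
    (by
      intro y hy hh
      have := hTN y hy
      have := hN y (by simp at hh ⊢; tauto)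
      omega)
    (by
      intro y hy hh
      have := hTN y hy
      have := hN y (by simp at hh ⊢; tauto)
      omega)
    (by simpa [piW] using h2)
  simp only [List.map_append, List.map_reverse, hTf, hZf] at h3
  have h4 := hV.cancel t (P ++ [z, z]) (x :: x :: (t ++ (t.reverse ++ x :: Z))) (by simpa using h3)
  have h5 := hV.con1 (P ++ [z]) (x :: (t ++ (t.reverse ++ x :: Z))) z x (by simpa using h4)
  have e : List.map (sub z x) (x :: (t ++ (t.reverse ++ x :: Z))) =
      x :: (t ++ (t.reverse ++ x :: Z)) := map_sub_fresh _ _ _ (by simp [hzx, hzt, hzZ])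
  rw [List.map_append, e, List.map_append, map_sub_fresh z x P hzP] at h5
  simpa [sub] using h5

theorem transport (hV : WordCat V) (h a : ℕ) (hpi : ∀ l, 1 ≤ l → l ≤ h + 1 → V (piW (List.range l)))
    (Q X : List ℕ) : ∀ (s P : List ℕ), (∀ U, U <+: X → (run s U).length ≤ h) → run s X = [] →
    V (P ++ (s ++ (a :: a :: (s.reverse ++ (X ++ Q))))) → V (P ++ (X ++ a :: a :: Q)) := by
  induction X with
  | nil =>
    intro s P _ hs hv
    rw [run_nil] at hs
    subst hs
    simpa using hv
  | cons x X ih =>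
    intro s P hU hs hv
    have hU' : ∀ U, U <+: X → (run (step s x) U).length ≤ h := by
      intro U hUX
      exact hU (x :: U) ((List.prefix_cons_inj x).2 hUX)
    have key : V ((P ++ [x]) ++ (step s x ++ (a :: a :: ((step s x).reverse ++ (X ++ Q))))) := by
      rcases step_cases s x with ⟨t', rfl, e⟩ | ⟨e, _⟩
      · rw [e]
        have := hV.con_eq (P ++ x :: (t' ++ (a :: a :: t'.reverse))) (X ++ Q) x (by simpa using hv)
        simpa using this
      · rw [e]
        have hl : s.length + 2 ≤ h + 1 := by
          have := hU [x] (by simp)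
          rw [run_cons, run_nil, e] at this
          simp at this; omega
        have := hV.proj (s ++ [a]) P (X ++ Q) x (by
          refine hpi _ ?_ ?_ <;> simp; omega) (by simpa using hv)
        simpa using this
    have := ih (step s x) (P ++ [x]) hU' hs key
    simpa using this

end WordCat

theorem piW_range {W : List ℕ → Prop} (hW : WordCat W) (G : List ℕ) (hG : G.Nodup)
    (h : W (piW G)) : W (piW (List.range G.length)) := by
  have h1 := hW.ren (piW G) (fun t => G.idxOf t) (by
    intro x hx y hy hxy
    have hx' : x ∈ G := by simpa [piW] using hx
    exact (List.idxOf_inj hx').1 hxy) h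
  have e : G.map (fun t => G.idxOf t) = List.range G.length := by
    apply List.ext_getElem
    · simp
    · intro i h1 h2
      simp [hG.idxOf_getElem]
  simpa [piW, e] using h1

theorem piW_down {W : List ℕ → Prop} (hW : WordCat W) (l : ℕ)
    (h : W (piW (List.range (l + 1)))) : W (piW (List.range l)) := by
  rw [List.range_succ] at h
  have h1 := hW.con_eq (List.range l) ((List.range l).reverse ++ (List.range l ++
    l :: l :: (List.range l).reverse)) l (by simpa [piW] using h)
  have h2 := hW.con_eq (List.range l ++ ((List.range l).reverse ++ List.range l))
    (List.range l).reverse l (by simpa using h1)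
  simpa [piW] using h2

theorem piW_le {W : List ℕ → Prop} (hW : WordCat W) (l m : ℕ) (hlm : l ≤ m)
    (h : W (piW (List.range m))) : W (piW (List.range l)) := by
  induction m, hlm using Nat.le_induction with
  | base => exact h
  | succ m _ ih => exact ih (piW_down hW m h)

theorem last_occ (c : ℕ) (l : List ℕ) (h : c ∈ l) : ∃ A B, l = A ++ c :: B ∧ c ∉ B := by
  obtain ⟨A, B, e, hA⟩ := List.eq_append_cons_of_mem (List.mem_reverse.2 h)
  refine ⟨B.reverse, A.reverse, ?_, by simpa using hA⟩
  have := congrArg List.reverse e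
  simpa using this

theorem parity_aux (n : ℕ) : (Odd n ↔ n % 2 = 1) ∧ (Even n ↔ n % 2 = 0) :=
  ⟨Nat.odd_iff, Nat.even_iff⟩

theorem Good.depth {W : List ℕ → Prop} (hW : Good W) (a : ℕ) (X Z : List ℕ)
    (h : W (a :: a :: (X ++ a :: Z))) (haX : a ∉ X) (hX : run [] X = [])
    (hXe : ∀ b, Even (X.count b))
    (hturn : ∀ c Y' Z', a :: a :: (X ++ a :: Z) = Y' ++ c :: c :: Z' → c ∈ Y' ∨ c ∈ Z')
    (hmin : ∀ c Y' V1 Z', a :: a :: (X ++ a :: Z) = Y' ++ c :: c :: (V1 ++ c :: Z') →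
      X.length ≤ V1.length)
    (U V : List ℕ) (hUV : X = U ++ V)
    (hmax : ∀ U', U' <+: X → (run [] U').length ≤ (run [] U).length)
    (hshort : ∀ U', U' <+: X → (run [] U').length = (run [] U).length → U.length ≤ U'.length) :
    W (piW (List.range ((run [] U).length + 1))) := by
  by_cases h0 : (run [] U).length = 0
  · rw [h0]; exact hW.four
  rcases List.eq_nil_or_concat U with rfl | ⟨U', c, hU⟩
  · exact absurd rfl h0
  simp only [List.concat_eq_append] at hU
  subst hU
  have hp' : U' <+: X := ⟨c :: V, by simp [hUV]⟩
  have hlt : (run [] U').length < (run [] (U' ++ [c])).length := by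
    refine lt_of_le_of_ne (hmax U' hp') (fun he => ?_)
    have := hshort U' hp' he
    simp at this
  have hrun : run [] (U' ++ [c]) = c :: run [] U' := by
    rw [run_append, run_cons, run_nil] at hlt ⊢
    rcases step_cases (run [] U') c with ⟨t', e1, e⟩ | ⟨e, _⟩
    · rw [e, e1] at hlt
      simp at hlt
    · exact e
  match V with
  | [] =>
    rw [List.append_nil] at hUV
    rw [← hUV, hX] at h0
    exact absurd rfl h0
  | c' :: V' =>
  have hcc : c' = c := by
    by_contra hne
    have := hmax ((U' ++ [c]) ++ [c']) ⟨V', by simp [hUV]⟩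
    rw [run_append (X := U' ++ [c]), hrun, run_cons, run_nil] at this
    simp [step, Ne.symm hne] at this
  subst hcc
  have hXe' : X = U' ++ c' :: c' :: V' := by simp [hUV]
  have hca : c' ≠ a := by
    rintro rfl
    exact haX (by simp [hXe'])
  have hcV : c' ∉ V' := by
    intro hc
    obtain ⟨V1, V2, rfl⟩ := List.append_of_mem hc
    have := hmin c' (a :: a :: U') V1 (V2 ++ a :: Z) (by simp [hXe'])
    rw [hXe'] at this
    simp at this; omega
  have hcU : c' ∉ U' := by
    intro hc
    obtain ⟨U1, U2, rfl, hc2⟩ := last_occ c' U' hc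
    have hw : W ((a :: a :: U1) ++ c' :: (U2 ++ c' :: (c' :: V' ++ a :: Z))) := by
      rw [hXe'] at h; simpa using h
    have hcl : run [] U2 = [] := by
      refine hW.closed (a :: a :: (U1 ++ [c'])) U2 (c' :: (c' :: V' ++ a :: Z)) (by simpa using hw) ?_
      intro x
      by_cases hx : c' = x
      · subst hx; rw [List.count_eq_zero_of_not_mem hc2]; exact Even.zero
      · exact hW.sep c' x _ U2 _ hx hw
    have e : run [] ((U1 ++ c' :: U2) ++ [c']) = run [] U1 := by
      have hch : List.IsChain (· ≠ ·) (run [] U1) := run_chain [] U1 (by simp)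
      rw [run_append, run_append, run_cons (run [] U1), run_closed _ _ (step_chain _ _ hch) hcl,
        run_cons, run_nil, step_step _ _ hch]
    have := hshort U1 ⟨c' :: (U2 ++ c' :: c' :: V'), by simp [hXe']⟩ (by rw [e])
    simp at this
  have hcZ : c' ∈ Z := by
    have := hturn c' (a :: a :: U') (V' ++ a :: Z) (by simp [hXe'])
    simpa [hca, hcV, hcU] using this
  obtain ⟨Z1, Z2, rfl, hcZ1⟩ := List.eq_append_cons_of_mem hcZ
  subst hXe'
  have hE := fun b => hW.even b _ h
  have hS : ∀ b, Even ((V' ++ a :: Z1).count b) := by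
    intro b
    by_cases hb : c' = b
    · subst hb
      rw [List.count_eq_zero_of_not_mem (by simp [hcV, hca, hcZ1])]; exact Even.zero
    · exact hW.sep c' b (a :: a :: (U' ++ [c'])) (V' ++ a :: Z1) Z2 hb (by simpa using h)
  have hrot := hW.rotate [a] (a :: ((U' ++ c' :: c' :: V') ++ a :: (Z1 ++ c' :: Z2))) (by simpa using h)
  have hL : W ([] ++ ((a :: (U' ++ [c'])) ++ ((c' :: (V' ++ [a])) ++ ((Z1 ++ [c']) ++ (Z2 ++ [a]))))) := by
    simpa using hrot
  have hpar : ∀ b, ((Odd ((a :: (U' ++ [c'])).count b) ↔ Odd ((c' :: (V' ++ [a])).count b)) ∧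
      (Odd ((c' :: (V' ++ [a])).count b) ↔ Odd ((Z1 ++ [c']).count b))) ∧
      (Odd ((Z1 ++ [c']).count b) ↔ Odd ((Z2 ++ [a]).count b)) := by
    intro b
    have e1 := hE b
    have e2 := hS b
    have e3 := hXe b
    simp only [List.count_cons, List.count_append, List.count_nil, Nat.odd_iff, Nat.even_iff] at e1 e2 e3 ⊢
    omega
  obtain ⟨g1, n1, m1⟩ := hW.leg_red _ _ _ hL
  have hlen : (run [] (a :: (U' ++ [c']))).length = (run [] (U' ++ [c'])).length + 1 := by
    have e : a ∉ U' ++ [c'] := by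
      intro hh
      apply haX
      simp at hh ⊢
      tauto
    have := run_bot [] (U' ++ [c']) a e
    rw [run_cons]
    change (run ([] ++ [a]) _).length = _
    rw [this]; simp
  generalize hR1 : (run [] (a :: (U' ++ [c']))).reverse = R1 at g1 n1 m1
  obtain ⟨g2, n2, m2⟩ := hW.leg_red R1 (c' :: (V' ++ [a])) ((Z1 ++ [c']) ++ (Z2 ++ [a])) (by simpa using g1)
  generalize (run [] (c' :: (V' ++ [a]))).reverse = R2 at g2 n2 m2
  obtain ⟨g3, n3, m3⟩ := hW.leg_red (R1 ++ R2) (Z1 ++ [c']) (Z2 ++ [a]) (by simpa using g2)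
  generalize (run [] (Z1 ++ [c'])).reverse = R3 at g3 n3 m3
  obtain ⟨g4, n4, m4⟩ := hW.leg_red (R1 ++ (R2 ++ R3)) (Z2 ++ [a]) [] (by simpa using g3)
  generalize (run [] (Z2 ++ [a])).reverse = R4 at g4 n4 m4
  have r2 := hW.rev_eq R1 [] R2 (R3 ++ R4) n1 n2
    (fun x => by rw [m1, m2]; exact (hpar x).1.1) (by simpa using g4)
  have r3 := hW.rev_eq R2 R1 R3 R4 n2 n3
    (fun x => by rw [m2, m3]; exact (hpar x).1.2) (by simpa using g4)
  have r4 := hW.rev_eq R3 (R1 ++ R2) R4 [] n3 n4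
    (fun x => by rw [m3, m4]; exact (hpar x).2) (by simpa using g4)
  have hfin : W (piW R1) := by
    rw [r4, r3, r2] at g4
    simpa [piW] using g4
  have := piW_range hW.toWordCat R1 n1 hfin
  rwa [← hR1, List.length_reverse, hlen] at this

theorem WordCat.isRot {W : List ℕ → Prop} (hW : WordCat W) {u v : List ℕ} (huv : u ~r v)
    (h : W u) : W v := by
  obtain ⟨n, rfl⟩ := huv
  rw [List.rotate_eq_drop_append_take_mod]
  apply hW.rotate
  rwa [List.take_append_drop]

theorem isRot_append (u v : List ℕ) : (u ++ v) ~r (v ++ u) := List.isRotated_append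

theorem exists_peak (X : List ℕ) : ∃ U V, X = U ++ V ∧
    (∀ U', U' <+: X → (run [] U').length ≤ (run [] U).length) ∧
    (∀ U', U' <+: X → (run [] U').length = (run [] U).length → U.length ≤ U'.length) := by
  obtain ⟨k, hk, hmax⟩ := Finset.exists_max_image (Finset.range (X.length + 1))
    (fun k => (run [] (X.take k)).length * (X.length + 1) + (X.length - k)) ⟨0, by simp⟩
  have hk' : k ≤ X.length := by simpa [Nat.lt_succ_iff] using hk
  have hlen : (X.take k).length = k := by simp [hk']
  have hm : ∀ U', U' <+: X → (run [] U').length * (X.length + 1) + (X.length - U'.length) ≤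
      (run [] (X.take k)).length * (X.length + 1) + (X.length - k) := by
    intro U' hU'
    have h1 := hmax U'.length (by simp; exact hU'.length_le)
    rwa [← List.prefix_iff_eq_take.1 hU'] at h1
  refine ⟨X.take k, X.drop k, (List.take_append_drop k X).symm, ?_, ?_⟩
  · intro U' hU'
    have := hm U' hU'
    by_contra hlt
    push Not at hlt
    have h2 := Nat.mul_le_mul_right (X.length + 1) (Nat.succ_le_of_lt hlt)
    rw [Nat.succ_mul] at h2
    omega
  · intro U' hU' he
    have := hm U' hU'
    rw [he] at this
    have := hU'.length_le
    omega

theorem Good.main {W V : List ℕ → Prop} (hW : Good W) (hV : WordCat V)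
    (hpi : ∀ l, 1 ≤ l → W (piW (List.range l)) → V (piW (List.range l))) (n : ℕ) :
    ∀ w : List ℕ, w.length < n → W w → V w := by
  induction n with
  | zero => intros; omega
  | succ n ih =>
  intro w hn h
  by_cases hcase : ∃ Y c Z, w ~r (Y ++ c :: c :: Z) ∧ c ∉ Y ∧ c ∉ Z
  · obtain ⟨Y, c, Z, hr, hY, hZ⟩ := hcase
    have h1 := hW.con_eq Y Z c (hW.isRot hr h)
    have hl := hr.perm.length_eq
    simp at hl
    have h2 := ih (Y ++ Z) (by simp; omega) h1
    exact hV.isRot hr.symm (hV.insp Y Z c h2 hY hZ)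
  push Not at hcase
  rcases chain_or w with hch | ⟨Y, t, Z, hw⟩
  · match w with
    | [] => exact hV.nil
    | b :: w =>
      exfalso
      have hnd := hW.nodup (b :: w) [] [] hch (by simpa using h)
      have he := hW.even b _ h
      rw [hnd.count, if_pos (by simp)] at he
      exact absurd he (by decide)
  classical
  have hex : ∃ m, ∃ a X Z, w ~r (a :: a :: (X ++ a :: Z)) ∧ X.length = m := by
    have hr : w ~r (t :: t :: (Z ++ Y)) := by
      rw [hw]; simpa using isRot_append Y (t :: t :: Z)
    have ht : t ∈ Z ++ Y := by
      by_contra hno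
      exact hno (hcase [] t (Z ++ Y) hr (by simp))
    obtain ⟨A, B, e⟩ := List.append_of_mem ht
    rw [e] at hr
    exact ⟨_, t, A, B, hr, rfl⟩
  obtain ⟨a, X, Z', hr, hXl⟩ := Nat.find_spec hex
  have hmin : ∀ c Y' V1 Z1, w ~r (Y' ++ c :: c :: (V1 ++ c :: Z1)) → X.length ≤ V1.length := by
    intro c Y' V1 Z1 hr'
    rw [hXl]
    refine Nat.find_min' hex ⟨c, V1, Z1 ++ Y', ?_, rfl⟩
    refine hr'.trans ?_
    simpa using isRot_append Y' (c :: c :: (V1 ++ c :: Z1))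
  clear hw Y Z t
  have h1 := hW.isRot hr h
  have haX : a ∉ X := by
    intro ha
    obtain ⟨A, B, e⟩ := List.append_of_mem ha
    have := hmin a [] A (B ++ a :: Z') (by rw [e] at hr; simpa using hr)
    rw [e] at this
    simp at this
  have hXe : ∀ b, Even (X.count b) := by
    intro b
    by_cases hb : a = b
    · subst hb; rw [List.count_eq_zero_of_not_mem haX]; exact Even.zero
    · exact hW.sep a b [a] X Z' hb h1
  have hX : run [] X = [] := hW.closed [a, a] X (a :: Z') h1 hXe
  obtain ⟨U, V0, hUV, hmax, hshort⟩ := exists_peak X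
  have hdepth := hW.depth a X Z' h1 haX hX hXe
    (by
      intro c Y' Z1 e
      by_contra hno
      push Not at hno
      exact hno.2 (hcase Y' c Z1 (e ▸ hr) hno.1))
    (by
      intro c Y' V1 Z1 e
      exact hmin c Y' V1 Z1 (e ▸ hr)) U V0 hUV hmax hshort
  have hVpi : ∀ l, 1 ≤ l → l ≤ (run [] U).length + 1 → V (piW (List.range l)) :=
    fun l h1 h2 => hpi l h1 (piW_le hW.toWordCat l _ h2 hdepth)
  have hl := hr.perm.length_eq
  have h2 := ih (X ++ a :: Z') (by simp at hl ⊢; omega) (hW.con_eq [] _ a h1)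
  obtain ⟨d, hd⟩ := exists_fresh (X ++ a :: Z')
  have h4 : V [0, 0, 0, 0] := hpi 1 le_rfl hW.four
  have h3 := hV.ins [] (X ++ a :: Z') [d, d, d, d] h2 (hV.four h4 d) (by simp at hd ⊢; exact hd)
  have h5 := hV.transport _ d hVpi (a :: Z') X [] [d, d] hmax hX (by simpa using h3)
  have h6 := hV.con1 ([d, d] ++ X ++ [d]) Z' d a (by simpa using h5)
  simp only [List.mem_append, List.mem_cons, not_or] at hd
  simp only [List.map_append, map_sub_fresh d a X hd.1, map_sub_fresh d a Z' hd.2.2] at h6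
  refine hV.isRot hr.symm ?_
  simpa [sub] using h6

theorem mem_eq_generated (C : PartitionCategory) (hC : Good (Wd C))
    (S : Set (Σ k l : ℕ, Partition k l)) (hS : S ⊆ C.mem)
    (hS' : ∀ l : ℕ, 1 ≤ l → (⟨0, 4 * l, piPartition l⟩ : Σ k l : ℕ, Partition k l) ∈ C.mem →
      (⟨0, 4 * l, piPartition l⟩ : Σ k l : ℕ, Partition k l) ∈ S) :
    C.mem = generated S := by
  apply Set.Subset.antisymm
  · refine mem_mono C (genCat S) (fun w hw => ?_)
    refine hC.main (Wd_cat (genCat S)) ?_ _ w (Nat.lt_succ_self _) hw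
    intro l hl h
    rw [Wd_pi] at h ⊢
    exact fun D hD => hD (hS' l hl h)
  · intro x hx
    exact hx C hS

theorem statement1 (C : PartitionCategory) :
    ¬ Hyperoctahedral C ∨
      ((∃ k : ℕ, 1 ≤ k ∧ C.mem = generated (piUpTo k)) ∨ C.mem = generated piAll) ∨
      (GroupTheoretical C ∧ Hyperoctahedral C) := by
  classical
  by_cases hH : Hyperoctahedral C
  swap
  · exact Or.inl hH
  by_cases hG : GroupTheoretical C
  · exact Or.inr (Or.inr ⟨hG, hH⟩)
  right; left
  have hW := Wd_cat C
  have hC : Good (Wd C) := hW.good ((Wd_four C).2 hH.1) (fun h => hH.2 ((Wd_double C).1 h))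
    (fun h => hG (Wd_positioner C h))
  by_cases hall : ∀ l : ℕ, 1 ≤ l → Wd C (piW (List.range l))
  · right
    refine mem_eq_generated C hC piAll ?_ (fun l hl _ => ⟨l, hl, rfl⟩)
    rintro x ⟨l, hl, rfl⟩
    exact (Wd_pi C l).1 (hall l hl)
  · left
    push Not at hall
    obtain ⟨hm1, hm2⟩ := Nat.find_spec hall
    have hmin : ∀ l, 1 ≤ l → l < Nat.find hall → Wd C (piW (List.range l)) := by
      intro l hl hlt
      by_contra hno
      exact Nat.find_min hall hlt ⟨hl, hno⟩
    generalize Nat.find hall = m at hm1 hm2 hmin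
    have hm3 : m ≠ 1 := by
      rintro rfl
      exact hm2 hC.four
    refine ⟨m - 1, by omega, mem_eq_generated C hC _ ?_ ?_⟩
    · rintro x ⟨l, hl, hlm, rfl⟩
      exact (Wd_pi C l).1 (hmin l hl (by omega))
    · intro l hl h
      refine ⟨l, hl, ?_, rfl⟩
      by_contra hno
      exact hm2 (piW_le hW m l (by omega) ((Wd_pi C l).2 h))

end EasyQG
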